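/- For every γ ∈ (0,1) there exists a constant d₀ such that the following holds for all d ≥ d₀ and all real k with 1 ≤ k ≤ d^{2γ}. Suppose G = (V,E) is a graph and ℋ = (L,H) is a correspondence cover of G such that: (S1) Δ(H) ≤ d; (S2) H is k-locally-sparse; (S3) for every v ∈ V(G), |L(v)| ≥ 4(1+γ)d / log(d/√k). Then G admits a proper ℋ-coloring. -/

import Mathlib

open Finset

attribute [local instance] Classical.propDecidable

noncomputable section

/-- The number of ordered pairs of adjacent vertices inside `S`; this is exactly twice the
number of edges of the subgraph induced on `S`. -/
def pairsWithin {V : Type} [Fintype V] (G : SimpleGraph V) (S : Finset V) : ℕ :=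
  ((S ×ˢ S).filter fun p => G.Adj p.1 p.2).card

/-- `G` is `k`-locally-sparse: each neighborhood induces at most `k` edges. -/
def LocallySparse {V : Type} [Fintype V] (G : SimpleGraph V) (k : ℝ) : Prop :=
  ∀ v : V, (pairsWithin G (G.neighborFinset v) : ℝ) ≤ 2 * k

/-- `(L, H)` is a correspondence cover of `G`. -/
structure IsCorrespondenceCover {V C : Type} (G : SimpleGraph V) (H : SimpleGraph C)
    (L : V → Finset C) : Prop where
  partition : ∀ c : C, ∃! v : V, c ∈ L v
  indep : ∀ v : V, ∀ c ∈ L v, ∀ c' ∈ L v, ¬H.Adj c c'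
  matching : ∀ u v : V, ∀ c ∈ L u, ∀ c₁ ∈ L v, ∀ c₂ ∈ L v,
    H.Adj c c₁ → H.Adj c c₂ → c₁ = c₂
  not_adj : ∀ u v : V, ¬G.Adj u v → ∀ c ∈ L u, ∀ c' ∈ L v, ¬H.Adj c c'

/-- Real-valued indicator of a proposition. -/
def ind (p : Prop) : ℝ := if p then 1 else 0

theorem ind_pos {p : Prop} (h : p) : ind p = 1 := by simp [ind, h]
theorem ind_neg {p : Prop} (h : ¬ p) : ind p = 0 := by simp [ind, h]
theorem ind_nonneg (p : Prop) : 0 ≤ ind p := by unfold ind; split_ifs <;> norm_num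
theorem ind_le_one (p : Prop) : ind p ≤ 1 := by unfold ind; split_ifs <;> norm_num
theorem ind_congr {p q : Prop} (h : p ↔ q) : ind p = ind q := by rw [propext h]
theorem ind_mono {p q : Prop} (h : p → q) : ind p ≤ ind q := by
  by_cases hp : p
  · rw [ind_pos hp, ind_pos (h hp)]
  · rw [ind_neg hp]; exact ind_nonneg q
theorem ind_and (p q : Prop) : ind (p ∧ q) = ind p * ind q := by
  by_cases hp : p <;> by_cases hq : q <;> simp [ind, hp, hq]

/-- Expectation with respect to a product of Bernoulli variables. -/
def EE {ι : Type} (π : ι → ℝ) (s : Finset ι) (f : Finset ι → ℝ) : ℝ :=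
  ∑ S ∈ s.powerset, (∏ i ∈ S, π i) * (∏ i ∈ s \ S, (1 - π i)) * f S

def PP {ι : Type} (π : ι → ℝ) (s : Finset ι) (A : Finset ι → Prop) : ℝ :=
  EE π s (fun S => ind (A S))

section prob
variable {ι : Type} {π : ι → ℝ}

theorem EE_empty (f : Finset ι → ℝ) : EE π ∅ f = f ∅ := by
  simp [EE]

theorem EE_insert {s : Finset ι} {i : ι} (hi : i ∉ s) (f : Finset ι → ℝ) :
    EE π (insert i s) f = (1 - π i) * EE π s f + π i * EE π s (fun S => f (insert i S)) := by
  unfold EE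
  rw [Finset.sum_powerset_insert hi, Finset.mul_sum, Finset.mul_sum]
  congr 1
  · apply Finset.sum_congr rfl
    intro S hS
    rw [Finset.mem_powerset] at hS
    have hiS : i ∉ S := fun h => hi (hS h)
    rw [Finset.insert_sdiff_of_notMem _ hiS, Finset.prod_insert (by simp [hi])]
    ring
  · apply Finset.sum_congr rfl
    intro S hS
    rw [Finset.mem_powerset] at hS
    have hiS : i ∉ S := fun h => hi (hS h)
    rw [Finset.prod_insert hiS, Finset.insert_sdiff_insert]
    rw [Finset.sdiff_insert_of_notMem hi]
    ring

theorem EE_add (s : Finset ι) (f g : Finset ι → ℝ) :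
    EE π s (fun S => f S + g S) = EE π s f + EE π s g := by
  simp [EE, mul_add, Finset.sum_add_distrib]

theorem EE_const_mul (s : Finset ι) (a : ℝ) (f : Finset ι → ℝ) :
    EE π s (fun S => a * f S) = a * EE π s f := by
  simp only [EE, Finset.mul_sum]
  apply Finset.sum_congr rfl
  intros; ring

theorem EE_sum {J : Type} (s : Finset ι) (t : Finset J) (f : J → Finset ι → ℝ) :
    EE π s (fun S => ∑ j ∈ t, f j S) = ∑ j ∈ t, EE π s (f j) := by
  simp only [EE, Finset.mul_sum]
  rw [Finset.sum_comm]

theorem EE_const (s : Finset ι) (a : ℝ) : EE π s (fun _ => a) = a := by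
  induction s using Finset.induction_on with
  | empty => simp [EE_empty]
  | insert i s hi ih => rw [EE_insert hi, ih]; ring

theorem EE_mono (hπ : ∀ i, 0 ≤ π i ∧ π i ≤ 1) (s : Finset ι) {f g : Finset ι → ℝ}
    (h : ∀ S, S ⊆ s → f S ≤ g S) : EE π s f ≤ EE π s g := by
  unfold EE
  apply Finset.sum_le_sum
  intro S hS
  apply mul_le_mul_of_nonneg_left (h S (Finset.mem_powerset.1 hS))
  apply mul_nonneg
  · exact Finset.prod_nonneg fun i _ => (hπ i).1
  · exact Finset.prod_nonneg fun i _ => by linarith [(hπ i).2]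

theorem EE_nonneg (hπ : ∀ i, 0 ≤ π i ∧ π i ≤ 1) (s : Finset ι) {f : Finset ι → ℝ}
    (h : ∀ S, 0 ≤ f S) : 0 ≤ EE π s f := by
  have := EE_mono hπ s (f := fun _ => 0) (g := f) (fun S _ => h S)
  rwa [EE_const] at this

theorem EE_mul_indep (s : Finset ι) : ∀ (f g : Finset ι → ℝ) (D E : Finset ι)
    (_ : Disjoint D E) (_ : ∀ S i, i ∉ D → f (insert i S) = f S)
    (_ : ∀ S i, i ∉ E → g (insert i S) = g S),
    EE π s (fun S => f S * g S) = EE π s f * EE π s g := by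
  induction s using Finset.induction_on with
  | empty => intros; simp [EE_empty]
  | insert i s hi ih =>
    intro f g D E hDE hf hg
    have hf' : ∀ S j, j ∉ D → f (insert i (insert j S)) = f (insert i S) := by
      intro S j hj; rw [Finset.insert_comm]; exact hf _ j hj
    have hg' : ∀ S j, j ∉ E → g (insert i (insert j S)) = g (insert i S) := by
      intro S j hj; rw [Finset.insert_comm]; exact hg _ j hj
    rw [EE_insert hi, EE_insert hi, EE_insert hi, ih f g D E hDE hf hg,
      ih (fun S => f (insert i S)) (fun S => g (insert i S)) D E hDE hf' hg']
    by_cases hiD : i ∈ D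
    · have hiE : i ∉ E := fun h => Finset.disjoint_left.1 hDE hiD h
      have : (fun S => g (insert i S)) = g := by funext S; exact hg S i hiE
      rw [this]; ring
    · have : (fun S => f (insert i S)) = f := by funext S; exact hf S i hiD
      rw [this]; ring

/-- dependence on a set of coordinates -/
def DepOn {α : Type} (D : Finset ι) (f : Finset ι → α) : Prop := ∀ S i, i ∉ D → f (insert i S) = f S

theorem EE_disjoint (s : Finset ι) : ∀ (B : Finset ι), B ⊆ s →
    EE π s (fun S => ind (Disjoint B S)) = ∏ i ∈ B, (1 - π i) := by
  induction s using Finset.induction_on with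
  | empty => intro B hB; simp [EE_empty, Finset.subset_empty.1 hB, ind]
  | insert i s hi ih =>
    intro B hB
    rw [EE_insert hi]
    by_cases hiB : i ∈ B
    · have h1 : (fun S => ind (Disjoint B (insert i S))) = fun _ => 0 := by
        funext S; rw [ind_neg]; simp [hiB]
      have h2 : EE π s (fun S => ind (Disjoint B S))
          = EE π s (fun S => ind (Disjoint (B.erase i) S)) := by
        unfold EE
        apply Finset.sum_congr rfl
        intro S hS
        rw [Finset.mem_powerset] at hS
        have hiS : i ∉ S := fun h => hi (hS h)
        have : Disjoint B S ↔ Disjoint (B.erase i) S := by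
          rw [Finset.disjoint_left, Finset.disjoint_left]
          constructor
          · intro h a ha; exact h (Finset.mem_of_mem_erase ha)
          · intro h a ha haS
            by_cases hai : a = i
            · exact hiS (hai ▸ haS)
            · exact h (Finset.mem_erase.2 ⟨hai, ha⟩) haS
        simp only [this]
      rw [h1, EE_const, h2, ih (B.erase i) (by
        intro a ha
        have := hB (Finset.mem_of_mem_erase ha)
        rw [Finset.mem_insert] at this
        exact this.resolve_left (Finset.ne_of_mem_erase ha)),
        ← Finset.mul_prod_erase B _ hiB]
      ring
    · have hBs : B ⊆ s := by
        intro a ha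
        have := hB ha
        rw [Finset.mem_insert] at this
        exact this.resolve_left (fun h => hiB (h ▸ ha))
      have h1 : (fun S => ind (Disjoint B (insert i S)))
          = (fun S => ind (Disjoint B S)) := by
        funext S; simp [hiB]
      rw [h1, ih B hBs]; ring

theorem PP_mono (hπ : ∀ i, 0 ≤ π i ∧ π i ≤ 1) (s : Finset ι) {A B : Finset ι → Prop}
    (h : ∀ S, S ⊆ s → A S → B S) : PP π s A ≤ PP π s B := by
  apply EE_mono hπ
  intro S hS
  exact ind_mono (h S hS)

theorem PP_nonneg (hπ : ∀ i, 0 ≤ π i ∧ π i ≤ 1) (s : Finset ι) (A : Finset ι → Prop) :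
    0 ≤ PP π s A := EE_nonneg hπ s fun S => ind_nonneg _

theorem PP_or (hπ : ∀ i, 0 ≤ π i ∧ π i ≤ 1) (s : Finset ι) (A B : Finset ι → Prop) :
    PP π s (fun S => A S ∨ B S) ≤ PP π s A + PP π s B := by
  unfold PP
  rw [← EE_add]
  apply EE_mono hπ
  intro S _
  by_cases h1 : A S <;> by_cases h2 : B S <;> simp [ind, h1, h2]

theorem PP_markov (hπ : ∀ i, 0 ≤ π i ∧ π i ≤ 1) (s : Finset ι) (f : Finset ι → ℝ) (l t : ℝ)
    (hl : 0 ≤ l) :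
    PP π s (fun S => t ≤ f S) ≤ Real.exp (-(l * t)) * EE π s (fun S => Real.exp (l * f S)) := by
  unfold PP
  rw [← EE_const_mul]
  apply EE_mono hπ
  intro S _
  rw [← Real.exp_add]
  by_cases h : t ≤ f S
  · rw [ind_pos h, ← Real.exp_zero]; apply Real.exp_le_exp.2; nlinarith
  · rw [ind_neg h]; positivity

/-- The symmetric local lemma. -/
theorem lll (hπ : ∀ i, 0 ≤ π i ∧ π i ≤ 1) (s : Finset ι) {V : Type} (W : Finset V)
    (A : V → Finset ι → Prop) (D : V → Finset ι) (hdep : ∀ v ∈ W, DepOn (D v) (A v))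
    (P0 N : ℝ) (hP : ∀ v ∈ W, PP π s (A v) ≤ P0) (hP0 : 0 ≤ P0)
    (hN : ∀ v ∈ W, ((W.filter fun w => ¬ Disjoint (D v) (D w)).card : ℝ) ≤ N) (hN1 : 1 ≤ N)
    (h : 4 * P0 * N ≤ 1) : ∃ S, S ⊆ s ∧ ∀ v ∈ W, ¬ A v S := by
  set Q : Finset V → ℝ := fun T => PP π s (fun S => ∀ w ∈ T, ¬ A w S) with hQ
  have hQ0 : ∀ T, 0 ≤ Q T := fun T => PP_nonneg hπ s _
  have key : ∀ n : ℕ, ∀ T : Finset V, T ⊆ W → T.card ≤ n → ∀ v ∈ W,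
      PP π s (fun S => A v S ∧ ∀ w ∈ T, ¬ A w S) ≤ 2 * P0 * Q T := by
    intro n
    induction n using Nat.strong_induction_on with
    | _ n ih =>
    intro T hTW hTn v hv
    set T1 := T.filter fun w => ¬ Disjoint (D v) (D w)
    set T2 := T.filter fun w => Disjoint (D v) (D w)
    have hle : PP π s (fun S => A v S ∧ ∀ w ∈ T, ¬ A w S) ≤ P0 * Q T2 := by
      calc PP π s (fun S => A v S ∧ ∀ w ∈ T, ¬ A w S)
          ≤ PP π s (fun S => A v S ∧ ∀ w ∈ T2, ¬ A w S) :=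
            PP_mono hπ s fun S _ hS => ⟨hS.1, fun w hw => hS.2 w (Finset.mem_filter.1 hw).1⟩
        _ = PP π s (A v) * Q T2 := by
            simp only [hQ, PP]
            rw [← EE_mul_indep s _ _ (D v) (T2.biUnion D)]
            · congr 1; funext S
              exact ind_and _ _
            · rw [Finset.disjoint_biUnion_right]
              intro w hw; exact (Finset.mem_filter.1 hw).2
            · intro S i hi
              rw [hdep v hv S i hi]
            · intro S i hi
              have : (∀ w ∈ T2, ¬ A w (insert i S)) ↔ ∀ w ∈ T2, ¬ A w S := by
                apply forall₂_congr
                intro w hw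
                rw [hdep w (hTW (Finset.mem_filter.1 hw).1) S i
                  (fun h => hi (Finset.mem_biUnion.2 ⟨w, hw, h⟩))]
              exact ind_congr this
        _ ≤ P0 * Q T2 := mul_le_mul_of_nonneg_right (hP v hv) (hQ0 _)
    have hge : Q T2 ≤ 2 * Q T := by
      by_cases hT1 : T1 = ∅
      · have : T2 = T := by
          apply Finset.filter_true_of_mem
          intro w hw
          by_contra hcon
          have : w ∈ T1 := Finset.mem_filter.2 ⟨hw, hcon⟩
          rw [hT1] at this; simp at this
        rw [this]; linarith [hQ0 T]
      · have hlt : T2.card < T.card := by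
          apply Finset.card_lt_card
          rw [Finset.ssubset_iff_subset_ne]
          refine ⟨Finset.filter_subset _ _, fun heq => ?_⟩
          obtain ⟨w, hw⟩ := Finset.nonempty_iff_ne_empty.2 hT1
          have hw' := Finset.mem_filter.1 hw
          rw [← heq] at hw'
          exact hw'.2 (Finset.mem_filter.1 hw'.1).2
        have h1 : Q T2 ≤ Q T + ∑ w ∈ T1, PP π s (fun S => A w S ∧ ∀ x ∈ T2, ¬ A x S) := by
          simp only [hQ, PP]
          rw [← EE_sum, ← EE_add]
          apply EE_mono hπ
          intro S _
          have hnn : ∀ w ∈ T1, 0 ≤ ind (A w S ∧ ∀ x ∈ T2, ¬ A x S) := by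
            intro w _; exact ind_nonneg _
          by_cases h2 : ∀ w ∈ T2, ¬ A w S
          · rw [ind_pos h2]
            by_cases h3 : ∀ w ∈ T, ¬ A w S
            · rw [ind_pos h3]; linarith [Finset.sum_nonneg hnn]
            · push Not at h3
              obtain ⟨w, hw, hAw⟩ := h3
              have hw1 : w ∈ T1 := by
                rw [Finset.mem_filter]
                refine ⟨hw, fun hd => h2 w (Finset.mem_filter.2 ⟨hw, hd⟩) hAw⟩
              have := Finset.single_le_sum hnn hw1
              rw [ind_pos ⟨hAw, h2⟩] at this
              have h4 : 0 ≤ ind (∀ w ∈ T, ¬ A w S) := ind_nonneg _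
              linarith
          · rw [ind_neg h2]
            have h4 : 0 ≤ ind (∀ w ∈ T, ¬ A w S) := ind_nonneg _
            linarith [Finset.sum_nonneg hnn]
        have h2 : ∑ w ∈ T1, PP π s (fun S => A w S ∧ ∀ x ∈ T2, ¬ A x S)
            ≤ T1.card * (2 * P0 * Q T2) := by
          rw [← nsmul_eq_mul]
          apply Finset.sum_le_card_nsmul
          intro w hw
          exact ih T2.card (lt_of_lt_of_le hlt hTn) T2 ((Finset.filter_subset _ _).trans hTW) le_rfl w
            (hTW (Finset.mem_filter.1 hw).1)
        have h3 : (T1.card : ℝ) ≤ N := by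
          refine le_trans ?_ (hN v hv)
          exact_mod_cast Finset.card_le_card (Finset.filter_subset_filter _ hTW)
        have h5 : (T1.card : ℝ) * (2 * P0 * Q T2) ≤ N * (2 * P0 * Q T2) :=
          mul_le_mul_of_nonneg_right h3 (by have := hQ0 T2; positivity)
        have h6 : N * (2 * P0 * Q T2) ≤ 1/2 * Q T2 := by nlinarith [hQ0 T2]
        linarith
    nlinarith
  have pos : ∀ T : Finset V, T ⊆ W → 0 < Q T := by
    intro T
    induction T using Finset.induction_on with
    | empty => intro _; simp [hQ, PP, EE_const, ind]
    | insert v T hvT ih =>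
      intro hTW
      have hT : T ⊆ W := fun x hx => hTW (Finset.mem_insert_of_mem hx)
      have h1 := key T.card T hT le_rfl v (hTW (Finset.mem_insert_self _ _))
      have h2 : Q T ≤ Q (insert v T) + PP π s (fun S => A v S ∧ ∀ w ∈ T, ¬ A w S) := by
        simp only [hQ, PP]
        rw [← EE_add]
        apply EE_mono hπ
        intro S _
        by_cases h2 : ∀ w ∈ T, ¬ A w S
        · by_cases h1 : A v S
          · rw [ind_pos (show A v S ∧ ∀ w ∈ T, ¬ A w S from ⟨h1, h2⟩), ind_pos h2]
            linarith [ind_nonneg (∀ w ∈ insert v T, ¬ A w S)]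
          · rw [ind_pos (show ∀ w ∈ insert v T, ¬ A w S by
              intro w hw; rcases Finset.mem_insert.1 hw with rfl | hw
              exacts [h1, h2 w hw]), ind_pos h2]
            linarith [ind_nonneg (A v S ∧ ∀ w ∈ T, ¬ A w S)]
        · rw [ind_neg h2]
          linarith [ind_nonneg (∀ w ∈ insert v T, ¬ A w S), ind_nonneg (A v S ∧ ∀ w ∈ T, ¬ A w S)]
      have h3 := ih hT
      have h4 : 2 * P0 ≤ 1/2 := by nlinarith
      nlinarith
  by_contra hcon
  push Not at hcon
  have : Q W ≤ 0 := by
    have h0 : Q W ≤ EE π s (fun _ => 0) := by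
      apply EE_mono hπ
      intro S hS
      obtain ⟨v, hv, hA⟩ := hcon S hS
      rw [ind_neg]
      intro h; exact h v hv hA
    rwa [EE_const] at h0
  linarith [pos W le_rfl]

end prob


section conc
variable {ι : Type} {π : ι → ℝ}

theorem exp_quad {y : ℝ} (hy : |y| ≤ 1) : Real.exp y ≤ 1 + y + y ^ 2 := by
  have := Real.abs_exp_sub_one_sub_id_le hy
  rw [abs_le] at this
  linarith [this.2]

theorem mgf_le (hπ : ∀ i, 0 ≤ π i ∧ π i ≤ 1) (l : ℝ) (a : ι → ℝ)
    (ha0 : ∀ i, 0 ≤ a i) (ha : ∀ i, |l| * a i ≤ 1) (s : Finset ι) : ∀ f : Finset ι → ℝ,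
    (∀ S i, |f (insert i S) - f S| ≤ a i) →
    EE π s (fun S => Real.exp (l * f S)) ≤
      Real.exp (l * EE π s f + l ^ 2 * ∑ i ∈ s, π i * a i ^ 2) := by
  induction s using Finset.induction_on with
  | empty => intro f hf; simp [EE_empty]
  | insert i s hi ih =>
    intro f hf
    rw [EE_insert hi, EE_insert hi, Finset.sum_insert hi]
    have h0 := ih f hf
    have h1 := ih (fun S => f (insert i S)) (by
      intro S j; rw [Finset.insert_comm]; exact hf _ j)
    set E0 := EE π s f
    set E1 := EE π s (fun S => f (insert i S))
    set Vs := ∑ i ∈ s, π i * a i ^ 2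
    have hΔ : |E1 - E0| ≤ a i := by
      rw [abs_le]
      constructor
      · have : E0 ≤ EE π s (fun S => f (insert i S) + a i) := by
          apply EE_mono hπ
          intro S _
          have := (abs_le.1 (hf S i)).1
          linarith
        rw [EE_add, EE_const] at this; linarith
      · have : E1 ≤ EE π s (fun S => f S + a i) := by
          apply EE_mono hπ
          intro S _
          have := (abs_le.1 (hf S i)).2
          linarith
        rw [EE_add, EE_const] at this; linarith
    have hy : |l * (E1 - E0)| ≤ 1 := by
      rw [abs_mul]
      exact le_trans (mul_le_mul_of_nonneg_left hΔ (abs_nonneg l)) (ha i)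
    have hq := exp_quad hy
    have hsq : (E1 - E0) ^ 2 ≤ a i ^ 2 := by
      rw [← sq_abs]; exact pow_le_pow_left₀ (abs_nonneg _) hΔ 2
    have hp0 := (hπ i).1
    have hp1 := (hπ i).2
    have hB : (1 - π i) + π i * Real.exp (l * (E1 - E0)) ≤
        Real.exp (π i * (l * (E1 - E0)) + l ^ 2 * (π i * a i ^ 2)) := by
      refine le_trans ?_ (Real.add_one_le_exp _)
      have h3 : π i * Real.exp (l * (E1 - E0)) ≤ π i * (1 + l * (E1 - E0) + (l * (E1 - E0)) ^ 2) :=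
        mul_le_mul_of_nonneg_left hq hp0
      have h4 : π i * (l * (E1 - E0)) ^ 2 ≤ l ^ 2 * (π i * a i ^ 2) := by
        have : π i * l ^ 2 * (E1 - E0) ^ 2 ≤ π i * l ^ 2 * a i ^ 2 :=
          mul_le_mul_of_nonneg_left hsq (by positivity)
        nlinarith
      nlinarith
    calc (1 - π i) * EE π s (fun S => Real.exp (l * f S))
          + π i * EE π s (fun S => Real.exp (l * f (insert i S)))
        ≤ (1 - π i) * Real.exp (l * E0 + l ^ 2 * Vs) + π i * Real.exp (l * E1 + l ^ 2 * Vs) :=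
          add_le_add (mul_le_mul_of_nonneg_left h0 (by linarith)) (mul_le_mul_of_nonneg_left h1 hp0)
      _ = Real.exp (l * E0 + l ^ 2 * Vs) * ((1 - π i) + π i * Real.exp (l * (E1 - E0))) := by
          have : Real.exp (l * E1 + l ^ 2 * Vs)
            = Real.exp (l * E0 + l ^ 2 * Vs) * Real.exp (l * (E1 - E0)) := by
            rw [← Real.exp_add]; congr 1; ring
          rw [this]; ring
      _ ≤ Real.exp (l * E0 + l ^ 2 * Vs) *
          Real.exp (π i * (l * (E1 - E0)) + l ^ 2 * (π i * a i ^ 2)) :=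
          mul_le_mul_of_nonneg_left hB (Real.exp_pos _).le
      _ = _ := by rw [← Real.exp_add]; congr 1; ring

/-- weighted count of the sets in a family avoided by the random set -/
def cnt {J : Type} (w : ℝ) (T : Finset J) (A : J → Finset ι) (S : Finset ι) : ℝ :=
  w * ∑ j ∈ T, ind (Disjoint (A j) S)

theorem EE_cnt [Fintype ι] {J : Type} (w : ℝ) (T : Finset J) (A : J → Finset ι) :
    EE π univ (cnt w T A) = w * ∑ j ∈ T, ∏ i ∈ A j, (1 - π i) := by
  unfold cnt
  rw [EE_const_mul, EE_sum]
  congr 1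
  apply Finset.sum_congr rfl
  intro j _
  exact EE_disjoint _ _ (Finset.subset_univ _)

theorem cnt_diff {J : Type} {w : ℝ} (hw : 0 ≤ w) (T : Finset J) (A : J → Finset ι)
    (S : Finset ι) (i : ι) :
    |cnt w T A (insert i S) - cnt w T A S| ≤ w * ∑ j ∈ T, ind (i ∈ A j) := by
  unfold cnt
  rw [← mul_sub, abs_mul, abs_of_nonneg hw, ← Finset.sum_sub_distrib]
  apply mul_le_mul_of_nonneg_left _ hw
  refine (Finset.abs_sum_le_sum_abs _ _).trans (Finset.sum_le_sum ?_)
  intro j _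
  by_cases hij : i ∈ A j
  · rw [ind_pos hij, abs_le]
    constructor <;>
    linarith [ind_nonneg (Disjoint (A j) (insert i S)), ind_nonneg (Disjoint (A j) S),
      ind_le_one (Disjoint (A j) (insert i S)), ind_le_one (Disjoint (A j) S)]
  · have : Disjoint (A j) (insert i S) ↔ Disjoint (A j) S := by simp [hij]
    rw [ind_congr this, ind_neg hij]; simp

theorem cnt_mgf [Fintype ι] (hπ : ∀ i, 0 ≤ π i ∧ π i ≤ 1) {J : Type} {w : ℝ} (hw : 0 ≤ w)
    (T : Finset J) (A : J → Finset ι) {b Wt : ℝ}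
    (hb : ∀ i, w * ∑ j ∈ T, ind (i ∈ A j) ≤ b)
    (hW : w * ∑ j ∈ T, ∑ i ∈ A j, π i ≤ Wt) (l : ℝ) (hl : |l| * b ≤ 1) (hlb : l ^ 2 * b ≤ 1)
    (hb0 : 0 ≤ b) :
    EE π univ (fun S => Real.exp (l * cnt w T A S)) ≤
      Real.exp (l * EE π univ (cnt w T A) + Wt) := by
  set a : ι → ℝ := fun i => w * ∑ j ∈ T, ind (i ∈ A j) with ha
  have ha0 : ∀ i, 0 ≤ a i := fun i => mul_nonneg hw (Finset.sum_nonneg fun j _ => ind_nonneg _)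
  refine (mgf_le hπ l a ha0 (fun i => le_trans (mul_le_mul_of_nonneg_left (hb i) (abs_nonneg l)) hl)
    univ (cnt w T A) (fun S i => cnt_diff hw T A S i)).trans ?_
  apply Real.exp_le_exp.2
  have h1 : ∑ i, π i * a i ^ 2 ≤ b * ∑ i, π i * a i := by
    rw [Finset.mul_sum]
    apply Finset.sum_le_sum
    intro i _
    have := mul_le_mul_of_nonneg_left (hb i) (mul_nonneg (hπ i).1 (ha0 i))
    calc π i * a i ^ 2 = π i * a i * a i := by ring
      _ ≤ π i * a i * b := this
      _ = _ := by ring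
  have h2 : ∑ i, π i * a i = w * ∑ j ∈ T, ∑ i ∈ A j, π i := by
    simp only [ha]
    have : ∀ i, π i * (w * ∑ j ∈ T, ind (i ∈ A j)) = w * ∑ j ∈ T, π i * ind (i ∈ A j) := by
      intro i; rw [Finset.mul_sum, Finset.mul_sum, Finset.mul_sum]
      apply Finset.sum_congr rfl; intros; ring
    simp only [this]
    rw [← Finset.mul_sum, Finset.sum_comm]
    congr 1
    apply Finset.sum_congr rfl
    intro j _
    rw [← Finset.sum_subset (Finset.subset_univ (A j))]
    · apply Finset.sum_congr rfl
      intro i hi; rw [ind_pos hi, mul_one]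
    · intro i _ hi; rw [ind_neg hi, mul_zero]
  have h3 : 0 ≤ ∑ i, π i * a i := Finset.sum_nonneg fun i _ => mul_nonneg (hπ i).1 (ha0 i)
  have h4 : l ^ 2 * ∑ i, π i * a i ^ 2 ≤ Wt := by
    calc l ^ 2 * ∑ i, π i * a i ^ 2 ≤ l ^ 2 * (b * ∑ i, π i * a i) :=
          mul_le_mul_of_nonneg_left h1 (by positivity)
      _ = (l ^ 2 * b) * ∑ i, π i * a i := by ring
      _ ≤ 1 * ∑ i, π i * a i := mul_le_mul_of_nonneg_right hlb h3
      _ ≤ Wt := by rw [one_mul, h2]; exact hW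
  linarith

theorem cnt_tail [Fintype ι] (hπ : ∀ i, 0 ≤ π i ∧ π i ≤ 1) {J : Type} {w : ℝ} (hw : 0 ≤ w)
    (T : Finset J) (A : J → Finset ι) {b Wt : ℝ} (t : ℝ) (hb0 : 0 < b) (hb1 : b ≤ 1)
    (hb : ∀ i, w * ∑ j ∈ T, ind (i ∈ A j) ≤ b)
    (hW : w * ∑ j ∈ T, ∑ i ∈ A j, π i ≤ Wt) :
    PP π univ (fun S => EE π univ (cnt w T A) + t ≤ cnt w T A S) ≤
      Real.exp (-(t / Real.sqrt b) + Wt) ∧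
    PP π univ (fun S => cnt w T A S ≤ EE π univ (cnt w T A) - t) ≤
      Real.exp (-(t / Real.sqrt b) + Wt) := by
  set l := 1 / Real.sqrt b with hldef
  have hs : 0 < Real.sqrt b := Real.sqrt_pos.2 hb0
  have hl : 0 < l := by positivity
  have hl2 : l ^ 2 * b = 1 := by
    rw [hldef, div_pow, Real.sq_sqrt hb0.le]; field_simp
  have hlb : l * b ≤ 1 := by
    have : l * b = Real.sqrt b := by
      rw [hldef]; nth_rewrite 2 [← Real.mul_self_sqrt hb0.le]; field_simp
    rw [this]; exact Real.sqrt_le_one.2 hb1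
  constructor
  · refine (PP_markov hπ univ (cnt w T A) l (EE π univ (cnt w T A) + t) hl.le).trans ?_
    have := cnt_mgf hπ hw T A hb hW l (by rw [abs_of_pos hl]; exact hlb) hl2.le hb0.le
    refine (mul_le_mul_of_nonneg_left this (Real.exp_pos _).le).trans ?_
    rw [← Real.exp_add]
    apply Real.exp_le_exp.2
    have : l * t = t / Real.sqrt b := by rw [hldef]; ring
    linarith
  · have h1 : PP π univ (fun S => cnt w T A S ≤ EE π univ (cnt w T A) - t) ≤
        PP π univ (fun S => -EE π univ (cnt w T A) + t ≤ - cnt w T A S) :=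
      PP_mono hπ _ fun S _ h => by linarith
    refine h1.trans ?_
    refine (PP_markov hπ univ (fun S => - cnt w T A S) l _ hl.le).trans ?_
    have := cnt_mgf hπ hw T A hb hW (-l) (by rw [abs_neg, abs_of_pos hl]; exact hlb)
      (by rw [neg_sq]; exact hl2.le) hb0.le
    have h2 : (fun S => Real.exp (l * -cnt w T A S)) = fun S => Real.exp (-l * cnt w T A S) := by
      funext S; congr 1; ring
    rw [h2]
    refine (mul_le_mul_of_nonneg_left this (Real.exp_pos _).le).trans ?_
    rw [← Real.exp_add]
    apply Real.exp_le_exp.2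
    have : l * t = t / Real.sqrt b := by rw [hldef]; ring
    linarith

end conc



section decoup
variable {ι : Type} {π : ι → ℝ}

theorem EE_step (hπ : ∀ i, 0 ≤ π i ∧ π i ≤ 1) {s : Finset ι} {x : ι} (hx : x ∈ s)
    (f h : Finset ι → ℝ)
    (H : ∀ S, x ∉ S → (1 - π x) * f S + π x * f (insert x S) ≤
      (1 - π x) * h S + π x * h (insert x S)) : EE π s f ≤ EE π s h := by
  rw [← Finset.insert_erase hx, EE_insert (Finset.notMem_erase x s),
    EE_insert (Finset.notMem_erase x s), ← EE_const_mul, ← EE_const_mul, ← EE_const_mul,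
    ← EE_const_mul, ← EE_add, ← EE_add]
  apply EE_mono hπ
  intro S hS
  exact H S (fun h => Finset.notMem_erase x s (hS h))

theorem lin_mgf [Fintype ι] (hπ : ∀ i, 0 ≤ π i ∧ π i ≤ 1) (g : ι → Finset ι → ℝ)
    (hg0 : ∀ x S, 0 ≤ g x S) (hg1 : ∀ x S, g x S ≤ 1) (P : Finset ι) :
    (∀ x S, ∀ i ∈ P, g x (insert i S) = g x S) →
    ∀ R : Finset ι → ℝ, (∀ S, 0 ≤ R S) → (∀ S, ∀ i ∈ P, R (insert i S) = R S) →
    EE π univ (fun S => Real.exp (∑ x ∈ P, ind (x ∈ S) * g x S) * R S) ≤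
    EE π univ (fun S => Real.exp (∑ x ∈ P, 2 * π x * g x S) * R S) := by
  induction P using Finset.induction_on with
  | empty => intros; simp
  | insert x P hx ih =>
    intro hgP R hR0 hR
    have hgP' : ∀ x S, ∀ i ∈ P, g x (insert i S) = g x S :=
      fun y S i hi => hgP y S i (Finset.mem_insert_of_mem hi)
    have h1 := ih hgP' (fun S => Real.exp (ind (x ∈ S) * g x S) * R S)
      (fun S => mul_nonneg (Real.exp_pos _).le (hR0 S)) (by
        intro S i hi
        have hne : x ≠ i := fun h => hx (h ▸ hi)
        have h2 : (x ∈ insert i S) ↔ x ∈ S := by simp [hne]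
        simp only [hgP' x S i hi, hR S i (Finset.mem_insert_of_mem hi), ind_congr h2])
    have e1 : (fun S => Real.exp (∑ y ∈ insert x P, ind (y ∈ S) * g y S) * R S) =
        fun S => Real.exp (∑ y ∈ P, ind (y ∈ S) * g y S) *
          (Real.exp (ind (x ∈ S) * g x S) * R S) := by
      funext S; rw [Finset.sum_insert hx, Real.exp_add]; ring
    rw [e1]
    refine h1.trans ?_
    apply EE_step hπ (Finset.mem_univ x)
    intro S hS
    have hxg : ∀ y, g y (insert x S) = g y S := fun y => hgP y S x (Finset.mem_insert_self _ _)
    have hxR := hR S x (Finset.mem_insert_self _ _)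
    simp only [Finset.sum_insert hx, hxg, hxR, ind_pos (Finset.mem_insert_self x S), ind_neg hS]
    set B := Real.exp (∑ y ∈ P, 2 * π y * g y S) with hB
    have hBp : 0 < B := Real.exp_pos _
    have hp0 := (hπ x).1
    have hp1 := (hπ x).2
    have hq : Real.exp (g x S) ≤ 1 + 2 * g x S := by
      have := exp_quad (y := g x S) (by rw [abs_of_nonneg (hg0 x S)]; exact hg1 x S)
      nlinarith [hg0 x S, hg1 x S]
    have hle : (1 - π x) + π x * Real.exp (g x S) ≤ Real.exp (2 * π x * g x S) := by
      refine le_trans ?_ (Real.add_one_le_exp _)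
      nlinarith
    rw [Real.exp_add, ← hB, zero_mul, Real.exp_zero, one_mul, one_mul]
    have := mul_le_mul_of_nonneg_right hle (mul_nonneg hBp.le (hR0 S))
    nlinarith

/-- The sum of weights of selected elements having a selected neighbour. -/
def ZZ [Fintype ι] (a : ι → ℝ) (N : ι → Finset ι) (S : Finset ι) : ℝ :=
  ∑ x, a x * (ind (x ∈ S) * ind (∃ y ∈ N x, y ∈ S))

def ZP [Fintype ι] (a : ι → ℝ) (N : ι → Finset ι) (P S : Finset ι) : ℝ :=
  ∑ x ∈ P, a x * (ind (x ∈ S) * ind (∃ y ∈ N x, y ∉ P ∧ y ∈ S))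

theorem ZP_mgf [Fintype ι] (hπ : ∀ i, 0 ≤ π i ∧ π i ≤ 1) (a : ι → ℝ) (N : ι → Finset ι)
    (ha : ∀ x, 0 ≤ a x) (hsymm : ∀ x y, y ∈ N x ↔ x ∈ N y)
    (l : ℝ) (hl : 0 ≤ l) (h1 : ∀ x, 4 * l * a x ≤ 1)
    (h2 : ∀ y, 8 * l * ∑ x ∈ N y, π x * a x ≤ 1) (P : Finset ι) :
    EE π univ (fun S => Real.exp (4 * l * ZP a N P S)) ≤
      Real.exp (16 * l * ∑ x, ∑ y ∈ N x, π x * π y * a x) := by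
  have s1 := lin_mgf hπ (fun x S => 4 * l * a x * ind (∃ y ∈ N x, y ∉ P ∧ y ∈ S))
    (fun x S => by have := ha x; have := ind_nonneg (∃ y ∈ N x, y ∉ P ∧ y ∈ S); positivity)
    (fun x S => by
      have := ha x
      have h3 := ind_le_one (∃ y ∈ N x, y ∉ P ∧ y ∈ S)
      have h4 : 0 ≤ 4 * l * a x := by positivity
      nlinarith [h1 x]) P
    (by
      intro x S i hi
      have : (∃ y ∈ N x, y ∉ P ∧ y ∈ insert i S) ↔ (∃ y ∈ N x, y ∉ P ∧ y ∈ S) := by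
        apply exists_congr; intro y
        apply and_congr_right; intro _
        apply and_congr_right; intro hy
        rw [Finset.mem_insert]
        constructor
        · rintro (h | h)
          · exact absurd (h ▸ hi) hy
          · exact h
        · exact Or.inr
      simp only [ind_congr this]) (fun _ => 1) (fun _ => zero_le_one) (fun _ _ _ => rfl)
  simp only [mul_one] at s1
  have e1 : (fun S => Real.exp (4 * l * ZP a N P S)) = fun S =>
      Real.exp (∑ x ∈ P, ind (x ∈ S) * (4 * l * a x * ind (∃ y ∈ N x, y ∉ P ∧ y ∈ S))) := by
    funext S; congr 1; unfold ZP; rw [Finset.mul_sum]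
    apply Finset.sum_congr rfl; intros; ring
  rw [e1]
  refine s1.trans ?_
  set G : ι → ℝ := fun y => 8 * l * ∑ x ∈ N y, π x * a x with hG
  have hG0 : ∀ y, 0 ≤ G y := fun y => mul_nonneg (by positivity)
    (Finset.sum_nonneg fun x _ => mul_nonneg (hπ x).1 (ha x))
  have s2 := lin_mgf hπ (fun y _ => G y) (fun y _ => hG0 y) (fun y _ => h2 y)
    Pᶜ (fun _ _ _ _ => rfl) (fun _ => 1) (fun _ => zero_le_one) (fun _ _ _ => rfl)
  simp only [mul_one] at s2
  rw [EE_const] at s2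
  refine le_trans (EE_mono hπ univ ?_) (s2.trans ?_)
  · intro S _
    apply Real.exp_le_exp.2
    calc ∑ x ∈ P, 2 * π x * (4 * l * a x * ind (∃ y ∈ N x, y ∉ P ∧ y ∈ S))
        ≤ ∑ x, 2 * π x * (4 * l * a x * ∑ y ∈ Pᶜ, ind (y ∈ S) * ind (x ∈ N y)) := by
          refine le_trans (Finset.sum_le_sum ?_) (Finset.sum_le_univ_sum_of_nonneg ?_)
          · intro x _
            have := (hπ x).1; have := ha x
            apply mul_le_mul_of_nonneg_left _ (by positivity)
            apply mul_le_mul_of_nonneg_left _ (by positivity)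
            have hnn : ∀ y ∈ Pᶜ, 0 ≤ ind (y ∈ S) * ind (x ∈ N y) :=
              fun y _ => mul_nonneg (ind_nonneg _) (ind_nonneg _)
            by_cases hex : ∃ y ∈ N x, y ∉ P ∧ y ∈ S
            · obtain ⟨y, hy, hyP, hyS⟩ := hex
              rw [ind_pos ⟨y, hy, hyP, hyS⟩]
              refine le_trans ?_ (Finset.single_le_sum hnn (Finset.mem_compl.2 hyP))
              rw [ind_pos hyS, ind_pos ((hsymm x y).1 hy)]; norm_num
            · rw [ind_neg hex]; exact Finset.sum_nonneg hnn
          · intro x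
            have := (hπ x).1; have := ha x
            have : 0 ≤ ∑ y ∈ Pᶜ, ind (y ∈ S) * ind (x ∈ N y) :=
              Finset.sum_nonneg fun y _ => mul_nonneg (ind_nonneg _) (ind_nonneg _)
            positivity
      _ = ∑ y ∈ Pᶜ, ind (y ∈ S) * G y := by
          simp only [Finset.mul_sum, hG]
          rw [Finset.sum_comm]
          apply Finset.sum_congr rfl
          intro y _
          rw [← Finset.sum_subset (Finset.subset_univ (N y))]
          · apply Finset.sum_congr rfl; intro x hx; rw [ind_pos hx]; ring
          · intro x _ hx; rw [ind_neg hx]; ring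
  · apply Real.exp_le_exp.2
    refine le_trans (Finset.sum_le_univ_sum_of_nonneg (fun y => by
      have := (hπ y).1; have := hG0 y; positivity)) ?_
    have : ∑ y, 2 * π y * G y = 16 * l * ∑ y, ∑ x ∈ N y, π x * π y * a x := by
      simp only [hG, Finset.mul_sum]
      apply Finset.sum_congr rfl; intro y _
      apply Finset.sum_congr rfl; intros; ring
    rw [this]
    apply le_of_eq
    congr 1
    have e : ∀ (F : ι → ι → ℝ), ∑ y, ∑ x ∈ N y, F x y = ∑ y, ∑ x, ind (x ∈ N y) * F x y := by
      intro F
      apply Finset.sum_congr rfl; intro y _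
      rw [← Finset.sum_subset (Finset.subset_univ (N y)) (f := fun x => ind (x ∈ N y) * F x y)]
      · apply Finset.sum_congr rfl; intro x hx; rw [ind_pos hx]; ring
      · intro x _ hx; rw [ind_neg hx]; ring
    rw [e, e (fun y x => π x * π y * a x), Finset.sum_comm]
    apply Finset.sum_congr rfl; intro x _
    apply Finset.sum_congr rfl; intro y _
    rw [ind_congr (hsymm x y)]

theorem EE_swap {κ : Type} {ρ : κ → ℝ} (s : Finset ι) (t : Finset κ)
    (f : Finset ι → Finset κ → ℝ) :
    EE π s (fun S => EE ρ t (fun T => f S T)) = EE ρ t (fun T => EE π s (fun S => f S T)) := by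
  unfold EE
  simp only [Finset.mul_sum]
  rw [Finset.sum_comm]
  apply Finset.sum_congr rfl; intro y _
  apply Finset.sum_congr rfl; intro x _
  ring

theorem ZZ_mgf [Fintype ι] (hπ : ∀ i, 0 ≤ π i ∧ π i ≤ 1) (a : ι → ℝ) (N : ι → Finset ι)
    (ha : ∀ x, 0 ≤ a x) (hsymm : ∀ x y, y ∈ N x ↔ x ∈ N y) (hirr : ∀ x, x ∉ N x)
    (l : ℝ) (hl : 0 ≤ l) (h1 : ∀ x, 4 * l * a x ≤ 1)
    (h2 : ∀ y, 8 * l * ∑ x ∈ N y, π x * a x ≤ 1) :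
    EE π univ (fun S => Real.exp (l * ZZ a N S)) ≤
      Real.exp (16 * l * ∑ x, ∑ y ∈ N x, π x * π y * a x) := by
  set ρ : ι → ℝ := fun _ => 1 / 2 with hρd
  have hρ : ∀ i, 0 ≤ ρ i ∧ ρ i ≤ 1 := fun i => by simp only [hρd]; norm_num
  have key : ∀ S, Real.exp (l * ZZ a N S) ≤
      EE ρ univ (fun P => Real.exp (4 * l * ZP a N P S)) := by
    intro S
    set m := l * ZZ a N S with hm
    have hE : m ≤ EE ρ univ (fun P => 4 * l * ZP a N P S) := by
      have e1 : (fun P => 4 * l * ZP a N P S) = fun P => 4 * l * ∑ x, a x * ind (x ∈ S) *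
          (ind (x ∈ P) * ind (∃ y ∈ N x, y ∉ P ∧ y ∈ S)) := by
        funext P
        unfold ZP
        congr 1
        rw [← Finset.sum_subset (Finset.subset_univ P)]
        · apply Finset.sum_congr rfl; intro x hx; rw [ind_pos hx]; ring
        · intro x _ hx; rw [ind_neg hx]; ring
      rw [e1, EE_const_mul, EE_sum, hm]
      unfold ZZ
      rw [mul_comm 4 l, mul_assoc]
      apply mul_le_mul_of_nonneg_left _ hl
      rw [Finset.mul_sum] 
      apply Finset.sum_le_sum
      intro x _
      rw [EE_const_mul]
      by_cases hex : ∃ y ∈ N x, y ∈ S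
      · rw [ind_pos hex]
        obtain ⟨y, hy, hyS⟩ := hex
        have hne : x ≠ y := fun h => hirr x (h ▸ hy)
        have h3 : (1:ℝ) / 4 ≤ EE ρ univ (fun P => ind (x ∈ P) * ind (∃ y ∈ N x, y ∉ P ∧ y ∈ S)) := by
          have h4 : EE ρ univ (fun P => ind (Disjoint {y} P) + (-1) * ind (Disjoint {x, y} P)) ≤
              EE ρ univ (fun P => ind (x ∈ P) * ind (∃ y ∈ N x, y ∉ P ∧ y ∈ S)) := by
            apply EE_mono hρ
            intro P _
            by_cases hyP : y ∈ P
            · rw [ind_neg (p := Disjoint {y} P) (by simp [hyP]),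
                ind_neg (p := Disjoint {x, y} P) (by simp [hyP])]
              have := mul_nonneg (ind_nonneg (x ∈ P)) (ind_nonneg (∃ y ∈ N x, y ∉ P ∧ y ∈ S))
              linarith
            · rw [ind_pos (p := ∃ y ∈ N x, y ∉ P ∧ y ∈ S) ⟨y, hy, hyP, hyS⟩,
                ind_pos (p := Disjoint {y} P) (by simp [hyP])]
              by_cases hxP : x ∈ P
              · rw [ind_pos hxP, ind_neg (by simp [hxP])]; norm_num
              · rw [ind_neg hxP, ind_pos (by simp [hxP, hyP])]; norm_num
          rw [EE_add, EE_const_mul, EE_disjoint _ _ (Finset.subset_univ _),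
            EE_disjoint _ _ (Finset.subset_univ _), Finset.prod_singleton,
            Finset.prod_pair hne] at h4
          refine le_trans ?_ h4
          simp only [hρd]; norm_num
        have := mul_nonneg (ha x) (ind_nonneg (x ∈ S))
        nlinarith
      · rw [ind_neg hex]
        have h5 : 0 ≤ EE ρ univ (fun P => ind (x ∈ P) * ind (∃ y ∈ N x, y ∉ P ∧ y ∈ S)) :=
          EE_nonneg hρ _ fun P => mul_nonneg (ind_nonneg _) (ind_nonneg _)
        have := mul_nonneg (ha x) (ind_nonneg (x ∈ S))
        have := mul_nonneg this h5
        linarith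
    have h6 : EE ρ univ (fun P => Real.exp m * (4 * l * ZP a N P S) + Real.exp m * (1 - m)) ≤
        EE ρ univ (fun P => Real.exp (4 * l * ZP a N P S)) := by
      apply EE_mono hρ
      intro P _
      set y := 4 * l * ZP a N P S
      have h7 := Real.add_one_le_exp (y - m)
      have h8 : Real.exp y = Real.exp m * Real.exp (y - m) := by
        rw [← Real.exp_add]; congr 1; ring
      rw [h8, ← mul_add]
      apply mul_le_mul_of_nonneg_left _ (Real.exp_pos _).le
      linarith
    rw [EE_add, EE_const_mul, EE_const] at h6
    have := mul_le_mul_of_nonneg_left hE (Real.exp_pos m).le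
    nlinarith
  refine (EE_mono hπ univ (fun S _ => key S)).trans ?_
  rw [EE_swap]
  refine (EE_mono hρ univ (fun P _ => ZP_mgf hπ a N ha hsymm l hl h1 h2 P)).trans ?_
  rw [EE_const]

theorem ZZ_tail [Fintype ι] (hπ : ∀ i, 0 ≤ π i ∧ π i ≤ 1) (a : ι → ℝ) (N : ι → Finset ι)
    (ha : ∀ x, 0 ≤ a x) (hsymm : ∀ x y, y ∈ N x ↔ x ∈ N y) (hirr : ∀ x, x ∉ N x)
    (l : ℝ) (hl : 0 ≤ l) (h1 : ∀ x, 4 * l * a x ≤ 1)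
    (h2 : ∀ y, 8 * l * ∑ x ∈ N y, π x * a x ≤ 1) {m : ℝ}
    (hm : ∑ x, ∑ y ∈ N x, π x * π y * a x ≤ m) (t : ℝ) :
    PP π univ (fun S => t ≤ ZZ a N S) ≤ Real.exp (-(l * t) + 16 * l * m) := by
  refine (PP_markov hπ univ (ZZ a N) l t hl).trans ?_
  rw [Real.exp_add]
  apply mul_le_mul_of_nonneg_left _ (Real.exp_pos _).le
  refine (ZZ_mgf hπ a N ha hsymm hirr l hl h1 h2).trans ?_
  apply Real.exp_le_exp.2
  exact mul_le_mul_of_nonneg_left hm (by positivity)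

end decoup


set_option linter.unusedSectionVars false
set_option linter.unusedVariables false
/-- Index type for the random coordinates: a selection coin and a phantom coin per colour. -/
inductive Ix (C : Type) : Type
  | tr (c : C) : Ix C
  | fa (c : C) : Ix C

def Ix.fst {C : Type} : Ix C → C
  | Ix.tr c => c
  | Ix.fa c => c

instance instFintypeIx {C : Type} [Fintype C] : Fintype (Ix C) :=
  Fintype.ofSurjective (Sum.elim Ix.tr Ix.fa : C ⊕ C → Ix C) (by
    intro i
    cases i with
    | tr c => exact ⟨Sum.inl c, rfl⟩
    | fa c => exact ⟨Sum.inr c, rfl⟩)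

def TT {C : Type} (X : Finset C) : Finset (Ix C) := X.image Ix.tr

theorem tr_mem_TT {C : Type} {X : Finset C} {x : C} : Ix.tr x ∈ TT X ↔ x ∈ X := by
  simp [TT]
theorem fa_mem_TT {C : Type} {X : Finset C} {x : C} : ¬ Ix.fa x ∈ TT X := by
  simp [TT]
theorem mem_TT {C : Type} {X : Finset C} {i : Ix C} : i ∈ TT X ↔ ∃ x ∈ X, Ix.tr x = i := by
  simp [TT]
theorem prod_TT {C : Type} (X : Finset C) (f : Ix C → ℝ) :
    ∏ i ∈ TT X, f i = ∏ x ∈ X, f (Ix.tr x) := by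
  unfold TT
  rw [Finset.prod_image]
  intro x _ y _ h
  exact Ix.tr.inj h
theorem sum_TT {C : Type} (X : Finset C) (f : Ix C → ℝ) :
    ∑ i ∈ TT X, f i = ∑ x ∈ X, f (Ix.tr x) := by
  unfold TT
  rw [Finset.sum_image]
  intro x _ y _ h
  exact Ix.tr.inj h

section graphs
variable {V C : Type} [Fintype C] (H : SimpleGraph C) (part : C → V)

def Nb (A : Finset C) (c : C) : Finset C := A.filter fun c' => H.Adj c c'
def Ls (A : Finset C) (v : V) : Finset C := A.filter fun c => part c = v
def nbr (A : Finset C) (c : C) : Finset C := A.filter fun c' => H.Adj c c' ∨ part c' = part c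
def Bl (A X : Finset C) : Finset C := X.biUnion (nbr H part A)
/-- the coordinates on which the events at `v` depend -/
def DD (A : Finset C) (v : V) : Finset (Ix C) :=
  univ.filter fun i => i.fst ∈ Bl H part A (Bl H part A (Bl H part A (Ls part A v)))

structure Nice (d : ℝ) (A : Finset C) : Prop where
  indep : ∀ c c', H.Adj c c' → part c ≠ part c'
  matching : ∀ c c₁ c₂, H.Adj c c₁ → H.Adj c c₂ → part c₁ = part c₂ → c₁ = c₂
  deg : ∀ c, ((Nb H A c).card : ℝ) ≤ d
  size : ∀ v, ((Ls part A v).card : ℝ) ≤ d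

def Colorable (W : Finset V) (A : Finset C) : Prop :=
  ∃ X : Finset C, X ⊆ A ∧ (∀ v ∈ W, ∃ x ∈ X, part x = v) ∧ ∀ x ∈ X, ∀ y ∈ X, ¬ H.Adj x y

structure State (W : Finset V) (A : Finset C) (p M θ a : ℝ) : Prop where
  hAW : ∀ c ∈ A, part c ∈ W
  ha : ∀ v ∈ W, p * (Ls part A v).card ≤ a
  hM : ∀ c ∈ A, p * (Nb H A c).card ≤ M
  hθ : ∀ v ∈ W, θ * M ≤ p * ∑ c ∈ Ls part A v, (M - p * (Nb H A c).card)

variable {H part} {A : Finset C} {d : ℝ}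

theorem mem_Nb {c c' : C} : c' ∈ Nb H A c ↔ c' ∈ A ∧ H.Adj c c' := by simp [Nb]
theorem mem_Ls {v : V} {c : C} : c ∈ Ls part A v ↔ c ∈ A ∧ part c = v := by simp [Ls]
theorem mem_nbr {c c' : C} : c' ∈ nbr H part A c ↔ c' ∈ A ∧ (H.Adj c c' ∨ part c' = part c) := by
  simp [nbr]
theorem mem_Bl {X : Finset C} {c : C} : c ∈ Bl H part A X ↔ ∃ x ∈ X, c ∈ nbr H part A x := by
  simp [Bl]

theorem Bl_sub (X : Finset C) : Bl H part A X ⊆ A := by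
  intro c hc
  obtain ⟨x, _, h⟩ := mem_Bl.1 hc
  exact (mem_nbr.1 h).1

theorem Ls_sub (v : V) : Ls part A v ⊆ A := fun c hc => (mem_Ls.1 hc).1

theorem self_Bl {X : Finset C} (hX : X ⊆ A) : X ⊆ Bl H part A X :=
  fun x hx => mem_Bl.2 ⟨x, hx, mem_nbr.2 ⟨hX hx, Or.inr rfl⟩⟩

theorem Bl_card (hn : Nice H part d A) (X : Finset C) :
    ((Bl H part A X).card : ℝ) ≤ (2 * d) * X.card := by
  have h1 : ∀ x ∈ X, ((nbr H part A x).card : ℝ) ≤ 2 * d := by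
    intro x _
    have : nbr H part A x = Nb H A x ∪ Ls part A (part x) := by
      ext c; rw [mem_nbr, Finset.mem_union, mem_Nb, mem_Ls]; tauto
    rw [this]
    have h2 : ((Nb H A x ∪ Ls part A (part x)).card : ℝ) ≤
        (Nb H A x).card + (Ls part A (part x)).card := by
      exact_mod_cast Finset.card_union_le _ _
    linarith [hn.deg x, hn.size (part x)]
  calc ((Bl H part A X).card : ℝ) ≤ ∑ x ∈ X, ((nbr H part A x).card : ℝ) := by
        exact_mod_cast Finset.card_biUnion_le
    _ ≤ ∑ x ∈ X, 2 * d := Finset.sum_le_sum h1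
    _ = _ := by rw [Finset.sum_const, nsmul_eq_mul]; ring

theorem Bl_back {Y Z : Finset C} (hY : Y ⊆ A) {z : C} (hz : z ∈ Z) (hzY : z ∈ Bl H part A Y) :
    ∃ y ∈ Y, y ∈ Bl H part A Z := by
  obtain ⟨y, hy, h⟩ := mem_Bl.1 hzY
  refine ⟨y, hy, mem_Bl.2 ⟨z, hz, mem_nbr.2 ⟨hY hy, ?_⟩⟩⟩
  rcases (mem_nbr.1 h).2 with h | h
  · exact Or.inl h.symm
  · exact Or.inr h.symm

theorem six_step (B : Finset C → Finset C) {d : ℝ} (hd : 0 ≤ d)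
    (hB' : ∀ X, ((B X).card : ℝ) ≤ (2 * d) * X.card) (X : Finset C) (hX : (X.card : ℝ) ≤ d) :
    ((B (B (B (B (B (B X)))))).card : ℝ) ≤ d * (2 * d) ^ 6 := by
  have h2d : 0 ≤ 2 * d := by linarith
  have hm : ∀ (X : Finset C) (r : ℝ), (X.card : ℝ) ≤ r → ((B X).card : ℝ) ≤ (2 * d) * r :=
    fun X r hr => (hB' X).trans (mul_le_mul_of_nonneg_left hr h2d)
  have h1 := hm X _ hX
  have h2 := hm (B X) _ h1
  have h3 := hm (B (B X)) _ h2
  have h4 := hm (B (B (B X))) _ h3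
  have h5 := hm (B (B (B (B X)))) _ h4
  have h6 := hm (B (B (B (B (B X))))) _ h5
  calc _ ≤ _ := h6
    _ = _ := by ring

theorem lll_local {π : Ix C → ℝ} (hπ : ∀ i, 0 ≤ π i ∧ π i ≤ 1) (hn : Nice H part d A)
    (hd : 1 ≤ d) (W : Finset V) (Bad : V → Finset (Ix C) → Prop)
    (hdep : ∀ v ∈ W, DepOn (DD H part A v) (Bad v)) (P0 : ℝ) (hP0 : 0 ≤ P0)
    (hP : ∀ v ∈ W, PP π univ (Bad v) ≤ P0) (h : 4 * P0 * (d * (2 * d) ^ 6) ≤ 1) :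
    ∃ S, ∀ v ∈ W, ¬ Bad v S := by
  suffices hs : ∃ S, S ⊆ (univ : Finset (Ix C)) ∧ ∀ v ∈ W, ¬ Bad v S by
    obtain ⟨S, _, hS⟩ := hs
    exact ⟨S, hS⟩
  apply lll hπ univ W Bad (DD H part A) hdep P0 (d * (2 * d) ^ 6) hP hP0 _ _ h
  · intro v _
    set B := Bl H part A with hB
    refine le_trans ?_ (six_step B (by linarith) (Bl_card hn) _ (hn.size v))
    refine le_trans (Nat.cast_le.2 (Finset.card_le_card
      (t := (B (B (B (B (B (B (Ls part A v))))))).image part) ?_))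
      (Nat.cast_le.2 Finset.card_image_le)
    · intro w hw
      rw [Finset.mem_filter, Finset.not_disjoint_iff] at hw
      obtain ⟨_, z, hz1, hz2⟩ := hw
      simp only [DD, Finset.mem_filter, Finset.mem_univ, true_and] at hz1 hz2
      obtain ⟨y1, hy1, hy1'⟩ := Bl_back (Bl_sub _) hz1 hz2
      obtain ⟨y2, hy2, hy2'⟩ := Bl_back (Bl_sub _) hy1' hy1
      obtain ⟨y3, hy3, hy3'⟩ := Bl_back (Ls_sub _) hy2' hy2
      exact Finset.mem_image.2 ⟨y3, hy3', (mem_Ls.1 hy3).2⟩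
  · have : (1:ℝ) ≤ (2 * d) ^ 6 := one_le_pow₀ (by linarith)
    nlinarith

/-- `x` is selected and none of its neighbours is. -/
def good (H : SimpleGraph C) (A : Finset C) (S : Finset (Ix C)) (x : C) : Prop :=
  Ix.tr x ∈ S ∧ Disjoint (TT (Nb H A x)) S

theorem good_nonadj {S : Finset (Ix C)} {x y : C} (hy : y ∈ A) (hx : good H A S x)
    (hy' : Ix.tr y ∈ S) : ¬ H.Adj x y := by
  intro h
  exact Finset.disjoint_left.1 hx.2 (tr_mem_TT.2 (mem_Nb.2 ⟨hy, h⟩)) hy'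

theorem disj_insert_of {D B S : Finset (Ix C)} {i : Ix C} (hB : B ⊆ D) (hi : i ∉ D) :
    Disjoint B (insert i S) ↔ Disjoint B S := by
  rw [Finset.disjoint_insert_right]
  exact ⟨fun h => h.2, fun h => ⟨fun h' => hi (hB h'), h⟩⟩

theorem good_dep {D S : Finset (Ix C)} {i : Ix C} {x : C} (hx : Ix.tr x ∈ D)
    (hB : TT (Nb H A x) ⊆ D) (hi : i ∉ D) :
    good H A (insert i S) x ↔ good H A S x := by
  unfold good
  rw [disj_insert_of hB hi, Finset.mem_insert]
  constructor
  · rintro ⟨h | h, h2⟩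
    · exact absurd (h ▸ hx) hi
    · exact ⟨h, h2⟩
  · rintro ⟨h, h2⟩; exact ⟨Or.inr h, h2⟩

theorem one_sub_ge_exp {y : ℝ} (h0 : 0 ≤ y) (h1 : y ≤ 1 / 2) :
    Real.exp (-(y * (1 + y))) ≤ 1 - y := by
  have h2 := Real.quadratic_le_exp_of_nonneg (x := y * (1 + y)) (by positivity)
  have h3 : 1 ≤ (1 - y) * Real.exp (y * (1 + y)) := by
    refine le_trans ?_ (mul_le_mul_of_nonneg_left h2 (by linarith))
    have h4 : 0 ≤ (1 - y) * (1 + y) ^ 2 - 2 * y := by nlinarith [mul_nonneg h0 h0]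
    nlinarith [mul_nonneg (mul_nonneg h0 h0) h4]
  rw [Real.exp_neg]
  have hp := Real.exp_pos (y * (1 + y))
  rw [inv_le_iff_one_le_mul₀ hp]; exact h3

end graphs


set_option linter.unusedSectionVars false
set_option linter.unusedVariables false
section final
variable {V C : Type} [Fintype C] {H : SimpleGraph C} {part : C → V}
variable {A : Finset C} {d : ℝ}

def supp (H : SimpleGraph C) (A : Finset C) (x : C) : Finset (Ix C) := insert (Ix.tr x) (TT (Nb H A x))

theorem tr_notMem_Nb (x : C) : Ix.tr x ∉ TT (Nb H A x) := by
  rw [tr_mem_TT, mem_Nb]; exact fun h => H.loopless.irrefl x h.2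

theorem good_prob {π : Ix C → ℝ} {q : ℝ} (hq : ∀ c, π (Ix.tr c) = q) (x : C) :
    EE π univ (fun S => ind (¬ good H A S x)) = 1 - q * (1 - q) ^ (Nb H A x).card := by
  have e : (fun S => ind (¬ good H A S x)) = fun S => 1 + ((-1) * ind (Disjoint (TT (Nb H A x)) S) +
      ind (Disjoint (supp H A x) S)) := by
    funext S
    have h2 : Disjoint (supp H A x) S ↔ Ix.tr x ∉ S ∧ Disjoint (TT (Nb H A x)) S := by
      unfold supp; rw [Finset.disjoint_insert_left]
    by_cases h1 : Disjoint (TT (Nb H A x)) S <;> by_cases h3 : Ix.tr x ∈ S <;>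
      simp [ind, good, h2, h1, h3]
  rw [e, EE_add, EE_add, EE_const, EE_const_mul, EE_disjoint _ _ (Finset.subset_univ _),
    EE_disjoint _ _ (Finset.subset_univ _)]
  unfold supp
  rw [Finset.prod_insert (tr_notMem_Nb x), prod_TT]
  simp only [hq, Finset.prod_const]
  ring

theorem uncol_prob {π : Ix C → ℝ} (hπ : ∀ i, 0 ≤ π i ∧ π i ≤ 1) (hn : Nice H part d A) {q r : ℝ}
    (hq : ∀ c, π (Ix.tr c) = q) (v : V) (hr0 : r ≤ 1)
    (hr : ∀ c ∈ A, r ≤ q * (1 - q) ^ (Nb H A c).card) (X : Finset C) :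
    X ⊆ Ls part A v → EE π univ (fun S => ind (∀ x ∈ X, ¬ good H A S x)) ≤ (1 - r) ^ X.card := by
  induction X using Finset.induction_on with
  | empty => intro _; simp [EE_const, ind]
  | insert x X hx ih =>
    intro hX
    have hX' : X ⊆ Ls part A v := fun y hy => hX (Finset.mem_insert_of_mem hy)
    have hxL := mem_Ls.1 (hX (Finset.mem_insert_self x X))
    have e : (fun S => ind (∀ y ∈ insert x X, ¬ good H A S y)) = fun S =>
        ind (¬ good H A S x) * ind (∀ y ∈ X, ¬ good H A S y) := by
      funext S; rw [← ind_and]; apply ind_congr; simp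
    rw [e, EE_mul_indep univ _ _ (supp H A x) (X.biUnion (supp H A))]
    · rw [good_prob hq, Finset.card_insert_of_notMem hx, pow_succ, mul_comm]
      have h1 := ih hX'
      have h2 := hr x hxL.1
      have h3 : 0 ≤ 1 - q * (1 - q) ^ (Nb H A x).card := by
        rw [← good_prob hq]; exact EE_nonneg hπ _ fun S => ind_nonneg _
      have h4 : 0 ≤ (1 - r) ^ X.card := pow_nonneg (by linarith) _
      exact mul_le_mul h1 (by linarith) h3 h4
    · rw [Finset.disjoint_biUnion_right]
      intro y hy
      have hyL := mem_Ls.1 (hX' hy)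
      have hne : x ≠ y := fun h => hx (h ▸ hy)
      have hpart : part x = part y := by rw [hxL.2, hyL.2]
      rw [Finset.disjoint_left]
      intro i hi hi'
      unfold supp at hi hi'
      rw [Finset.mem_insert] at hi hi'
      rcases hi with rfl | hi
      · rcases hi' with h | h
        · exact hne (Ix.tr.inj h)
        · rw [tr_mem_TT, mem_Nb] at h
          exact hn.indep _ _ h.2 hpart.symm
      · obtain ⟨z, hz, rfl⟩ := mem_TT.1 hi
        rw [mem_Nb] at hz
        rcases hi' with h | h
        · rw [Ix.tr.inj h] at hz
          exact hn.indep _ _ hz.2 hpart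
        · rw [tr_mem_TT, mem_Nb] at h
          exact hne (hn.matching z x y hz.2.symm h.2.symm hpart)
    · intro S i hi
      apply ind_congr
      rw [good_dep (D := supp H A x) (Finset.mem_insert_self _ _) (Finset.subset_insert _ _) hi]
    · intro S i hi
      apply ind_congr
      apply forall₂_congr
      intro y hy
      rw [good_dep (D := supp H A y) (Finset.mem_insert_self _ _) (Finset.subset_insert _ _)
        (fun h => hi (Finset.mem_biUnion.2 ⟨y, hy, h⟩))]

theorem mem_DD {v : V} {i : Ix C} : i ∈ DD H part A v ↔
    i.fst ∈ Bl H part A (Bl H part A (Bl H part A (Ls part A v))) := by simp [DD]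

theorem DD1 {v : V} {c x : C} (hc : c ∈ Ls part A v) (hx : x ∈ nbr H part A c) (i : Ix C)
    (hi : i.fst = x) : i ∈ DD H part A v := by
  rw [mem_DD, hi]
  exact self_Bl (Bl_sub _) (self_Bl (Bl_sub _) (mem_Bl.2 ⟨c, hc, hx⟩))

theorem DD2 {v : V} {c x y : C} (hc : c ∈ Ls part A v) (hx : x ∈ nbr H part A c)
    (hy : y ∈ nbr H part A x) (i : Ix C) (hi : i.fst = y) : i ∈ DD H part A v := by
  rw [mem_DD, hi]
  exact self_Bl (Bl_sub _) (mem_Bl.2 ⟨x, mem_Bl.2 ⟨c, hc, hx⟩, hy⟩)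

theorem DD3 {v : V} {c x y z : C} (hc : c ∈ Ls part A v) (hx : x ∈ nbr H part A c)
    (hy : y ∈ nbr H part A x) (hz : z ∈ nbr H part A y) (i : Ix C) (hi : i.fst = z) :
    i ∈ DD H part A v := by
  rw [mem_DD, hi]
  exact mem_Bl.2 ⟨y, mem_Bl.2 ⟨x, mem_Bl.2 ⟨c, hc, hx⟩, hy⟩, hz⟩

theorem nbr_self {c : C} (hc : c ∈ A) : c ∈ nbr H part A c := mem_nbr.2 ⟨hc, Or.inr rfl⟩
theorem nbr_Nb {c c' : C} (hc : c' ∈ Nb H A c) : c' ∈ nbr H part A c :=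
  mem_nbr.2 ⟨(mem_Nb.1 hc).1, Or.inl (mem_Nb.1 hc).2⟩

theorem state_theta {W : Finset V} {p M θ a : ℝ} (hst : State H part W A p M θ a) (hp : 0 < p)
    (hM0 : 0 < M) {v : V} (hv : v ∈ W) : θ ≤ p * (Ls part A v).card := by
  have h1 := hst.hθ v hv
  have h2 : ∑ c ∈ Ls part A v, (M - p * (Nb H A c).card) ≤ ∑ c ∈ Ls part A v, M := by
    apply Finset.sum_le_sum
    intro c _
    have : (0:ℝ) ≤ p * (Nb H A c).card := by positivity
    linarith
  rw [Finset.sum_const, nsmul_eq_mul] at h2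
  have h3 := h1.trans (mul_le_mul_of_nonneg_left h2 hp.le)
  rw [← mul_assoc] at h3
  exact le_of_mul_le_mul_right h3 hM0

theorem final_color (hn : Nice H part d A) (hd : 1 ≤ d) {W : Finset V} {p M θ a μ : ℝ}
    (hst : State H part W A p M θ a) (hp : 0 < p) (hM0 : 0 < M) (hθ : 1 / 2 ≤ θ)
    (hμ : 0 < μ) (hμp : μ * p ≤ 1 / 2) (hμM : μ * M ≤ 1 / 2)
    (hL : 4 * Real.exp (-(μ / 4)) * (d * (2 * d) ^ 6) ≤ 1) : Colorable H part W A := by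
  set π : Ix C → ℝ := fun i => match i with
    | Ix.tr _ => μ * p
    | Ix.fa _ => 0 with hπd
  have hq : ∀ c, π (Ix.tr c) = μ * p := fun c => rfl
  have hμp0 : 0 < μ * p := by positivity
  have hπ : ∀ i, 0 ≤ π i ∧ π i ≤ 1 := by
    intro i
    cases i with
    | tr c => rw [hq c]; constructor <;> linarith
    | fa c => simp [hπd]
  suffices hs : ∃ S, ∀ v ∈ W, ¬ ∀ x ∈ Ls part A v, ¬ good H A S x by
    obtain ⟨S, hS⟩ := hs
    refine ⟨A.filter (good H A S), Finset.filter_subset _ _, ?_, ?_⟩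
    · intro v hv
      have := hS v hv
      push Not at this
      obtain ⟨x, hx, hg⟩ := this
      exact ⟨x, Finset.mem_filter.2 ⟨(mem_Ls.1 hx).1, hg⟩, (mem_Ls.1 hx).2⟩
    · intro x hx y hy
      rw [Finset.mem_filter] at hx hy
      exact good_nonadj hy.1 hx.2 hy.2.1
  apply lll_local hπ hn hd W (fun v S => ∀ x ∈ Ls part A v, ¬ good H A S x) _
    (Real.exp (-(μ / 4))) (Real.exp_pos _).le _ hL
  · intro v hv S i hi
    apply propext
    apply forall₂_congr
    intro x hx
    rw [good_dep (D := DD H part A v) (DD1 hx (nbr_self (mem_Ls.1 hx).1) _ rfl) _ hi]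
    intro j hj
    obtain ⟨y, hy, rfl⟩ := mem_TT.1 hj
    exact DD1 hx (nbr_Nb hy) _ rfl
  · intro v hv
    have h1 := uncol_prob hπ hn hq v (r := μ * p / 2) (by linarith) (by
      intro c hc
      have h2 := one_add_mul_le_pow (a := -(μ * p)) (by linarith) (Nb H A c).card
      have h3 := hst.hM c hc
      have h4 : (Nb H A c).card * (μ * p) ≤ 1 / 2 := by nlinarith
      have h5 : 1 / 2 ≤ (1 - μ * p) ^ (Nb H A c).card := by
        rw [sub_eq_add_neg]; linarith
      nlinarith) (Ls part A v) subset_rfl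
    unfold PP
    refine h1.trans ?_
    have h6 : (1 - μ * p / 2) ≤ Real.exp (-(μ * p / 2)) := by
      linarith [Real.add_one_le_exp (-(μ * p / 2))]
    refine (pow_le_pow_left₀ (by linarith) h6 _).trans ?_
    rw [← Real.exp_nat_mul]
    apply Real.exp_le_exp.2
    have h7 := state_theta hst hp hM0 hv
    nlinarith

end final


set_option linter.unusedSectionVars false
set_option linter.unusedVariables false

structure RPar (p M θ a η : ℝ) : Prop where
  hp : 0 < p
  hM : 0 < M
  hpM : 12 * p * (M + 1) ≤ 1
  hη : 0 < η
  hη1 : η ≤ 1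
  hηM : η * M ≤ 1 / 4
  hθ1 : θ ≤ 1
  hθ : 1 / 2 + η ≤ θ
  ha : a ≤ 2

theorem RPar.hp1 {p M θ a η : ℝ} (h : RPar p M θ a η) : p ≤ 1 / 12 := by
  have := h.hp; have := h.hM; have := h.hpM; nlinarith

def KK (η M : ℝ) : ℝ := Real.exp (-(η * M * (1 + η)))

section round1
variable {V C : Type} [Fintype C] {H : SimpleGraph C} {part : C → V}
variable {A : Finset C} {d : ℝ} {W : Finset V} {p M θ a η : ℝ}

def rpi (H : SimpleGraph C) (A : Finset C) (η p M : ℝ) : Ix C → ℝ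
  | Ix.tr _ => η * p
  | Ix.fa c => if c ∈ A then 1 - KK η M / (1 - η * p) ^ (Nb H A c).card else 0

def Blk (H : SimpleGraph C) (A : Finset C) (c : C) : Finset (Ix C) :=
  insert (Ix.fa c) (TT (Nb H A c))

theorem KK_pos : 0 < KK η M := Real.exp_pos _

theorem KK_half (h : RPar p M θ a η) : 1 / 2 ≤ KK η M := by
  unfold KK
  have := Real.add_one_le_exp (-(η * M * (1 + η)))
  have h1 := h.hηM; have h2 := h.hη1; have h3 := h.hη; have h4 := h.hM
  have : 0 < η * M := by positivity
  nlinarith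

theorem KK_le_pow (h : RPar p M θ a η) {n : ℕ} (hn : p * n ≤ M) :
    KK η M ≤ (1 - η * p) ^ n := by
  have h1 := h.hηM; have h2 := h.hη1; have h3 := h.hη; have h4 := h.hM
  have h5 := h.hp; have h6 := h.hp1
  have hy : η * p ≤ 1 / 2 := by nlinarith
  have hy0 : 0 ≤ η * p := by positivity
  have := pow_le_pow_left₀ (Real.exp_pos _).le (one_sub_ge_exp hy0 hy) n
  refine le_trans ?_ this
  rw [← Real.exp_nat_mul]
  unfold KK
  apply Real.exp_le_exp.2
  have h7 : η * p * n * (1 + η * p) ≤ η * M * (1 + η) := by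
    apply mul_le_mul
    · rw [mul_assoc]; exact mul_le_mul_of_nonneg_left hn h3.le
    · nlinarith
    · linarith
    · positivity
  nlinarith

theorem rpi_prob (h : RPar p M θ a η) (hst : State H part W A p M θ a) :
    ∀ i, 0 ≤ rpi H A η p M i ∧ rpi H A η p M i ≤ 1 := by
  intro i
  have h1 := h.hηM; have h2 := h.hη1; have h3 := h.hη; have h4 := h.hM
  have h5 := h.hp; have h6 := h.hp1
  have hy : η * p ≤ 1 / 2 := by nlinarith
  cases i with
  | tr c => simp only [rpi]; constructor; positivity; linarith
  | fa c =>
    simp only [rpi]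
    split_ifs with hc
    · have hpos : 0 < (1 - η * p) ^ (Nb H A c).card := pow_pos (by linarith) _
      have := div_le_one_of_le₀ (KK_le_pow h (hst.hM c hc)) hpos.le
      have h7 : 0 ≤ KK η M / (1 - η * p) ^ (Nb H A c).card := div_nonneg KK_pos.le hpos.le
      constructor <;> linarith
    · norm_num

theorem rpi_fa (h : RPar p M θ a η) {c : C} (hc : c ∈ A) :
    (1 - rpi H A η p M (Ix.fa c)) * (1 - η * p) ^ (Nb H A c).card = KK η M := by
  have h2 := h.hη1; have h3 := h.hη
  have h5 := h.hp; have h6 := h.hp1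
  have hy : η * p ≤ 1 / 2 := by nlinarith
  have hpos : 0 < (1 - η * p) ^ (Nb H A c).card := pow_pos (by linarith) _
  simp only [rpi, if_pos hc]
  field_simp
  ring

theorem blk_prod (h : RPar p M θ a η) {c : C} (hc : c ∈ A) :
    ∏ i ∈ Blk H A c, (1 - rpi H A η p M i) = KK η M := by
  unfold Blk
  rw [Finset.prod_insert fa_mem_TT, prod_TT, ← rpi_fa (H := H) h hc]
  simp [rpi]

theorem blk_sum (h : RPar p M θ a η) (hst : State H part W A p M θ a) {c : C} (hc : c ∈ A) :
    ∑ i ∈ Blk H A c, rpi H A η p M i ≤ 3 / 2 := by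
  unfold Blk
  rw [Finset.sum_insert fa_mem_TT, sum_TT]
  have h1 := (rpi_prob h hst (Ix.fa c)).2
  have h2 : ∑ x ∈ Nb H A c, rpi H A η p M (Ix.tr x) = η * (p * (Nb H A c).card) := by
    simp only [rpi, Finset.sum_const, nsmul_eq_mul]; ring
  have h3 := mul_le_mul_of_nonneg_left (hst.hM c hc) h.hη.le
  rw [h2]
  linarith [h.hηM]

theorem sum_ind_le_one {J : Type} (X : Finset J) (P : J → Prop)
    (h : ∀ x ∈ X, ∀ y ∈ X, P x → P y → x = y) : ∑ x ∈ X, ind (P x) ≤ 1 := by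
  by_cases hex : ∃ x ∈ X, P x
  · obtain ⟨x, hx, hPx⟩ := hex
    rw [Finset.sum_eq_single_of_mem x hx]
    · exact ind_le_one _
    · intro y hy hne
      exact ind_neg fun hPy => hne (h y hy x hx hPy hPx)
  · push Not at hex
    rw [Finset.sum_eq_zero fun x hx => ind_neg (hex x hx)]; norm_num

theorem blk_count (hn : Nice H part d A) (v : V) (i : Ix C) :
    ∑ c ∈ Ls part A v, ind (i ∈ Blk H A c) ≤ 1 := by
  apply sum_ind_le_one
  intro x hx y hy h1 h2
  rw [mem_Ls] at hx hy
  unfold Blk at h1 h2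
  rw [Finset.mem_insert] at h1 h2
  cases i with
  | tr z =>
    rcases h1 with h1 | h1
    · cases h1
    rcases h2 with h2 | h2
    · cases h2
    rw [tr_mem_TT, mem_Nb] at h1 h2
    exact hn.matching z x y h1.2.symm h2.2.symm (by rw [hx.2, hy.2])
  | fa z =>
    rcases h1 with h1 | h1
    · rcases h2 with h2 | h2
      · exact (Ix.fa.inj h1).symm.trans (Ix.fa.inj h2)
      · exact absurd h2 fa_mem_TT
    · exact absurd h1 fa_mem_TT

theorem pK_le (h : RPar p M θ a η) : p / KK η M ≤ 2 * p := by
  rw [div_le_iff₀ KK_pos]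
  nlinarith [KK_half h, h.hp]

theorem f1_mean (h : RPar p M θ a η) (v : V) :
    EE (rpi H A η p M) univ (cnt (p / KK η M) (Ls part A v) (Blk H A)) =
      p * (Ls part A v).card := by
  rw [EE_cnt]
  have : ∑ j ∈ Ls part A v, ∏ i ∈ Blk H A j, (1 - rpi H A η p M i) =
      (Ls part A v).card * KK η M := by
    rw [Finset.sum_congr rfl fun c hc => blk_prod h (mem_Ls.1 hc).1, Finset.sum_const, nsmul_eq_mul]
  rw [this]
  have := (KK_pos (η := η) (M := M)).ne'
  field_simp

theorem f1_tail (h : RPar p M θ a η) (hst : State H part W A p M θ a) (hn : Nice H part d A)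
    {v : V} (hv : v ∈ W) (t : ℝ) :
    PP (rpi H A η p M) univ (fun S => p * (Ls part A v).card + t ≤
      cnt (p / KK η M) (Ls part A v) (Blk H A) S) ≤ Real.exp (-(t / Real.sqrt (2 * p)) + 8) ∧
    PP (rpi H A η p M) univ (fun S => cnt (p / KK η M) (Ls part A v) (Blk H A) S ≤
      p * (Ls part A v).card - t) ≤ Real.exp (-(t / Real.sqrt (2 * p)) + 8) := by
  have hp := h.hp
  have hp1 := h.hp1
  have hw : 0 ≤ p / KK η M := div_nonneg hp.le KK_pos.le
  rw [← f1_mean h v]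
  apply cnt_tail (rpi_prob h hst) hw _ _ t (by linarith) (by linarith)
  · intro i
    refine (mul_le_mul_of_nonneg_left (blk_count hn v i) hw).trans ?_
    rw [mul_one]; exact pK_le h
  · have h1 : ∑ j ∈ Ls part A v, ∑ i ∈ Blk H A j, rpi H A η p M i ≤
        (Ls part A v).card * (3 / 2) := by
      rw [← nsmul_eq_mul]
      exact Finset.sum_le_card_nsmul _ _ _ fun c hc => blk_sum h hst (mem_Ls.1 hc).1
    refine (mul_le_mul_of_nonneg_left h1 hw).trans ?_
    have h2 : (0:ℝ) ≤ (Ls part A v).card * (3 / 2) := by positivity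
    refine (mul_le_mul_of_nonneg_right (pK_le h) h2).trans ?_
    have := hst.ha v hv
    have := h.ha
    nlinarith

end round1


set_option linter.unusedSectionVars false
set_option linter.unusedVariables false
section round2
variable {V C : Type} [Fintype C] {H : SimpleGraph C} {part : C → V}
variable {A : Finset C} {d : ℝ} {W : Finset V} {p M θ a η k : ℝ}

def Fam (H : SimpleGraph C) (part : C → V) (A : Finset C) (j : (_ : C) × C) : Finset (Ix C) :=
  Blk H A j.1 ∪ (Blk H A j.2 ∪ TT (Ls part A (part j.2)))

def Tv (H : SimpleGraph C) (part : C → V) (A : Finset C) (v : V) : Finset ((_ : C) × C) :=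
  (Ls part A v).sigma fun c => Nb H A c

theorem sum_Tv (v : V) (f : (_ : C) × C → ℝ) :
    ∑ j ∈ Tv H part A v, f j = ∑ c ∈ Ls part A v, ∑ c' ∈ Nb H A c, f ⟨c, c'⟩ := by
  unfold Tv; rw [Finset.sum_sigma]

theorem ind_union {α : Type} (X Y : Finset α) (i : α) : ind (i ∈ X ∪ Y) ≤ ind (i ∈ X) + ind (i ∈ Y) := by
  by_cases h1 : i ∈ X <;> by_cases h2 : i ∈ Y <;> simp [ind, h1, h2]

theorem pair_card (hst : State H part W A p M θ a) (hp : 0 < p) (hM : 0 < M) (ha : a ≤ 2) {v : V}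
    (hv : v ∈ W) : p * (p * ∑ c ∈ Ls part A v, ((Nb H A c).card : ℝ)) ≤ 2 * M := by
  have h1 : p * ∑ c ∈ Ls part A v, ((Nb H A c).card : ℝ) ≤ (Ls part A v).card * M := by
    rw [Finset.mul_sum, ← nsmul_eq_mul]
    exact Finset.sum_le_card_nsmul _ _ _ fun c hc => hst.hM c (mem_Ls.1 hc).1
  have h2 := mul_le_mul_of_nonneg_left h1 hp.le
  have h3 := hst.ha v hv
  nlinarith

theorem count_second (hn : Nice H part d A) (hst : State H part W A p M θ a) (hp : 0 < p)
    (hM : 0 < M) (v : V) (i : Ix C) :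
    p * ∑ c ∈ Ls part A v, ∑ c' ∈ Nb H A c, ind (i ∈ Blk H A c') ≤ M + p := by
  have h1 : ∑ c ∈ Ls part A v, ∑ c' ∈ Nb H A c, ind (i ∈ Blk H A c') ≤
      ∑ c' ∈ A, ind (i ∈ Blk H A c') := by
    have e : ∀ c ∈ Ls part A v, ∑ c' ∈ Nb H A c, ind (i ∈ Blk H A c') =
        ∑ c' ∈ A, ind (H.Adj c c') * ind (i ∈ Blk H A c') := by
      intro c _
      unfold Nb
      rw [Finset.sum_filter]
      apply Finset.sum_congr rfl
      intro c' _
      by_cases h : H.Adj c c' <;> simp [ind, h]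
    rw [Finset.sum_congr rfl e, Finset.sum_comm]
    apply Finset.sum_le_sum
    intro c' _
    rw [← Finset.sum_mul]
    have : ∑ c ∈ Ls part A v, ind (H.Adj c c') ≤ 1 := by
      apply sum_ind_le_one
      intro x hx y hy h1 h2
      rw [mem_Ls] at hx hy
      exact hn.matching c' x y h1.symm h2.symm (by rw [hx.2, hy.2])
    nlinarith [ind_nonneg (i ∈ Blk H A c')]
  refine (mul_le_mul_of_nonneg_left h1 hp.le).trans ?_
  cases i with
  | fa z =>
    have : ∑ c' ∈ A, ind (Ix.fa z ∈ Blk H A c') ≤ 1 := by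
      apply sum_ind_le_one
      intro x hx y hy h1 h2
      unfold Blk at h1 h2
      rw [Finset.mem_insert] at h1 h2
      exact (Ix.fa.inj (h1.resolve_right fa_mem_TT)).symm.trans
        (Ix.fa.inj (h2.resolve_right fa_mem_TT))
    nlinarith
  | tr z =>
    have h2 : ∀ c' , ind (Ix.tr z ∈ Blk H A c') = ind (z ∈ Nb H A c') := by
      intro c'
      apply ind_congr
      unfold Blk
      rw [Finset.mem_insert, tr_mem_TT]
      constructor
      · rintro (h | h)
        · cases h
        · exact h
      · exact Or.inr
    simp only [h2]
    by_cases hz : z ∈ A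
    · have : ∑ c' ∈ A, ind (z ∈ Nb H A c') = (Nb H A z).card := by
        rw [Finset.card_eq_sum_ones, Nat.cast_sum]
        unfold Nb
        rw [Finset.sum_filter]
        apply Finset.sum_congr rfl
        intro c' _
        by_cases h : H.Adj c' z
        · simp [ind, h, hz, h.symm]
        · have : ¬ H.Adj z c' := fun h' => h h'.symm
          simp [ind, h, this]
      rw [this]
      linarith [hst.hM z hz]
    · have : ∑ c' ∈ A, ind (z ∈ Nb H A c') = 0 := by
        apply Finset.sum_eq_zero
        intro c' _
        exact ind_neg fun h => hz (mem_Nb.1 h).1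
      rw [this, mul_zero]; linarith

theorem count_third (hn : Nice H part d A) (v : V) (P : V → Prop)
    (hP : ∀ u w, P u → P w → u = w) :
    ∑ c ∈ Ls part A v, ∑ c' ∈ Nb H A c, ind (P (part c')) ≤ (Ls part A v).card := by
  have : ∀ c ∈ Ls part A v, ∑ c' ∈ Nb H A c, ind (P (part c')) ≤ 1 := by
    intro c _
    apply sum_ind_le_one
    intro x hx y hy h1 h2
    exact hn.matching c x y (mem_Nb.1 hx).2 (mem_Nb.1 hy).2 (hP _ _ h1 h2)
  have := Finset.sum_le_card_nsmul _ _ _ this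
  simpa using this

theorem fam_count (h : RPar p M θ a η) (hst : State H part W A p M θ a) (hn : Nice H part d A)
    {v : V} (hv : v ∈ W) (i : Ix C) :
    p * ∑ j ∈ Tv H part A v, ind (i ∈ Fam H part A j) ≤ 3 * (M + 1) := by
  have hp := h.hp
  rw [sum_Tv]
  have h1 : ∑ c ∈ Ls part A v, ∑ c' ∈ Nb H A c, ind (i ∈ Fam H part A ⟨c, c'⟩) ≤
      ∑ c ∈ Ls part A v, ∑ c' ∈ Nb H A c, ind (i ∈ Blk H A c) +
      ∑ c ∈ Ls part A v, ∑ c' ∈ Nb H A c, ind (i ∈ Blk H A c') +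
      ∑ c ∈ Ls part A v, ∑ c' ∈ Nb H A c, ind (i ∈ TT (Ls part A (part c'))) := by
    rw [← Finset.sum_add_distrib, ← Finset.sum_add_distrib]
    apply Finset.sum_le_sum
    intro c _
    rw [← Finset.sum_add_distrib, ← Finset.sum_add_distrib]
    apply Finset.sum_le_sum
    intro c' _
    unfold Fam
    linarith [ind_union (Blk H A c) (Blk H A c' ∪ TT (Ls part A (part c'))) i,
      ind_union (Blk H A c') (TT (Ls part A (part c'))) i]
  refine (mul_le_mul_of_nonneg_left h1 hp.le).trans ?_
  have a1 : p * ∑ c ∈ Ls part A v, ∑ c' ∈ Nb H A c, ind (i ∈ Blk H A c) ≤ M := by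
    have : p * ∑ c ∈ Ls part A v, ∑ c' ∈ Nb H A c, ind (i ∈ Blk H A c) ≤
        ∑ c ∈ Ls part A v, M * ind (i ∈ Blk H A c) := by
      rw [Finset.mul_sum]
      apply Finset.sum_le_sum
      intro c hc
      rw [Finset.sum_const, nsmul_eq_mul, ← mul_assoc]
      exact mul_le_mul_of_nonneg_right (hst.hM c (mem_Ls.1 hc).1) (ind_nonneg _)
    rw [← Finset.mul_sum] at this
    nlinarith [blk_count hn v i, h.hM]
  have a2 := count_second hn hst hp h.hM v i
  have a3 : p * ∑ c ∈ Ls part A v, ∑ c' ∈ Nb H A c, ind (i ∈ TT (Ls part A (part c'))) ≤ 2 := by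
    have := count_third hn v (fun u => i ∈ TT (Ls part A u)) (by
      intro u w hu hw
      obtain ⟨x, hx, rfl⟩ := mem_TT.1 hu
      rw [tr_mem_TT] at hw
      rw [← (mem_Ls.1 hx).2, ← (mem_Ls.1 hw).2])
    have h3 := hst.ha v hv
    have := h.ha
    nlinarith
  have := h.hp1
  have := h.hM
  nlinarith

theorem fam_sum (h : RPar p M θ a η) (hst : State H part W A p M θ a) {c c' : C}
    (hc : c ∈ A) (hc' : c' ∈ A) : ∑ i ∈ Fam H part A ⟨c, c'⟩, rpi H A η p M i ≤ 5 := by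
  have hu : ∀ X Y : Finset (Ix C), ∑ i ∈ X ∪ Y, rpi H A η p M i ≤
      ∑ i ∈ X, rpi H A η p M i + ∑ i ∈ Y, rpi H A η p M i := by
    intro X Y
    rw [← Finset.sum_union_inter]
    have := Finset.sum_nonneg (s := X ∩ Y) fun i _ => (rpi_prob h hst i).1
    linarith
  unfold Fam
  have h1 := hu (Blk H A c) (Blk H A c' ∪ TT (Ls part A (part c')))
  have h2 := hu (Blk H A c') (TT (Ls part A (part c')))
  have h3 := blk_sum h hst hc
  have h4 := blk_sum h hst hc'
  have h5 : ∑ i ∈ TT (Ls part A (part c')), rpi H A η p M i ≤ 2 := by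
    rw [sum_TT]
    simp only [rpi, Finset.sum_const, nsmul_eq_mul]
    have h6 := hst.ha _ (hst.hAW c' hc')
    have := h.ha
    have h7 : (0:ℝ) ≤ p * (Ls part A (part c')).card := by have := h.hp; positivity
    nlinarith [h.hη1, h.hη]
  simp only at *
  linarith

theorem pK_sq_le (h : RPar p M θ a η) : (p / KK η M) ^ 2 ≤ 4 * p ^ 2 := by
  have := pow_le_pow_left₀ (div_nonneg h.hp.le KK_pos.le) (pK_le h) 2
  nlinarith

theorem f2_tail (h : RPar p M θ a η) (hst : State H part W A p M θ a) (hn : Nice H part d A)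
    {v : V} (hv : v ∈ W) (t : ℝ) :
    PP (rpi H A η p M) univ (fun S => EE (rpi H A η p M) univ
        (cnt ((p / KK η M) ^ 2) (Tv H part A v) (Fam H part A)) + t ≤
      cnt ((p / KK η M) ^ 2) (Tv H part A v) (Fam H part A) S) ≤
      Real.exp (-(t / Real.sqrt (12 * p * (M + 1))) + 40 * M) := by
  have hp := h.hp
  have hM := h.hM
  have hw : 0 ≤ (p / KK η M) ^ 2 := sq_nonneg _
  refine (cnt_tail (rpi_prob h hst) hw _ _ t (by positivity) h.hpM ?_ ?_).1
  · intro i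
    have h0 : 0 ≤ ∑ j ∈ Tv H part A v, ind (i ∈ Fam H part A j) :=
      Finset.sum_nonneg fun j _ => ind_nonneg _
    refine (mul_le_mul_of_nonneg_right (pK_sq_le h) h0).trans ?_
    have := mul_le_mul_of_nonneg_left (fam_count h hst hn hv i) (by positivity : 0 ≤ 4 * p)
    nlinarith
  · have h0 : 0 ≤ ∑ j ∈ Tv H part A v, ∑ i ∈ Fam H part A j, rpi H A η p M i :=
      Finset.sum_nonneg fun j _ => Finset.sum_nonneg fun i _ => (rpi_prob h hst i).1
    refine (mul_le_mul_of_nonneg_right (pK_sq_le h) h0).trans ?_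
    have h1 : ∑ j ∈ Tv H part A v, ∑ i ∈ Fam H part A j, rpi H A η p M i ≤
        5 * ∑ c ∈ Ls part A v, ((Nb H A c).card : ℝ) := by
      rw [sum_Tv, Finset.mul_sum]
      apply Finset.sum_le_sum
      intro c hc
      have := Finset.sum_le_card_nsmul (Nb H A c) (fun c' => ∑ i ∈ Fam H part A ⟨c, c'⟩, rpi H A η p M i) 5
        fun c' hc' => fam_sum h hst (mem_Ls.1 hc).1 (mem_Nb.1 hc').1
      rw [nsmul_eq_mul] at this
      linarith
    have h2 := mul_le_mul_of_nonneg_left h1 (by positivity : 0 ≤ 4 * p ^ 2)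
    have h3 := pair_card hst hp hM h.ha hv
    nlinarith

theorem fam_prod (h : RPar p M θ a η) (hst : State H part W A p M θ a) (hn : Nice H part d A)
    {c c' : C} (hc : c ∈ A) (hc' : c' ∈ Nb H A c) :
    ∏ i ∈ Fam H part A ⟨c, c'⟩, (1 - rpi H A η p M i) ≤
      KK η M ^ 2 * ((1 - η / 2) * (1 + 4 * (η * p) * ((Nb H A c ∩ Nb H A c').card + 1))) := by
  rw [mem_Nb] at hc'
  obtain ⟨hc'A, hadj⟩ := hc'
  have hp := h.hp
  have hM := h.hM
  have h2 := h.hη1; have h3 := h.hη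
  have h6 := h.hp1
  have hθ := h.hθ
  have hy : η * p ≤ 1 / 12 := by nlinarith
  have hne : c ≠ c' := hadj.ne
  set q := 1 - η * p with hq
  set U := Nb H A c ∪ (Nb H A c' ∪ Ls part A (part c')) with hU
  have hset : Fam H part A ⟨c, c'⟩ = insert (Ix.fa c) (insert (Ix.fa c') (TT U)) := by
    unfold Fam Blk
    ext i
    simp only [Finset.mem_union, Finset.mem_insert]
    cases i with
    | tr z => simp only [tr_mem_TT, hU, Finset.mem_union, reduceCtorEq, false_or]
    | fa z => simp only [fa_mem_TT, Ix.fa.injEq, or_false]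
  have hprod : ∏ i ∈ Fam H part A ⟨c, c'⟩, (1 - rpi H A η p M i) =
      (1 - rpi H A η p M (Ix.fa c)) * ((1 - rpi H A η p M (Ix.fa c')) * q ^ U.card) := by
    rw [hset, Finset.prod_insert, Finset.prod_insert fa_mem_TT, prod_TT]
    · simp [rpi, hq]
    · rw [Finset.mem_insert]
      rintro (h | h)
      · exact hne (Ix.fa.inj h)
      · exact fa_mem_TT h
  set t := (Nb H A c ∩ Nb H A c').card with ht
  have hcard : (Nb H A c).card + (Nb H A c').card + (Ls part A (part c')).card ≤ U.card + (t + 1) := by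
    have e1 := Finset.card_union_add_card_inter (Nb H A c) (Nb H A c' ∪ Ls part A (part c'))
    have e2 : (Nb H A c' ∪ Ls part A (part c')).card = (Nb H A c').card + (Ls part A (part c')).card := by
      apply Finset.card_union_of_disjoint
      rw [Finset.disjoint_left]
      intro x hx hx'
      exact hn.indep _ _ (mem_Nb.1 hx).2 (mem_Ls.1 hx').2.symm
    have e3 : (Nb H A c ∩ (Nb H A c' ∪ Ls part A (part c'))).card ≤ t + 1 := by
      rw [Finset.inter_union_distrib_left]
      refine (Finset.card_union_le _ _).trans (Nat.add_le_add_left ?_ _)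
      rw [Finset.card_le_one]
      intro x hx y hy
      rw [Finset.mem_inter] at hx hy
      exact hn.matching c x y (mem_Nb.1 hx.1).2 (mem_Nb.1 hy.1).2
        (by rw [(mem_Ls.1 hx.2).2, (mem_Ls.1 hy.2).2])
    rw [← hU] at e1
    omega
  have hq0 : 0 < q := by rw [hq]; linarith
  have hq1 : q ≤ 1 := by rw [hq]; nlinarith
  have hL : q ^ (Ls part A (part c')).card ≤ 1 - η / 2 := by
    have g1 : q ≤ Real.exp (-(η * p)) := by
      rw [hq]; linarith [Real.add_one_le_exp (-(η * p))]
    refine (pow_le_pow_left₀ hq0.le g1 _).trans ?_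
    rw [← Real.exp_nat_mul]
    have g2 := state_theta hst hp hM (hst.hAW c' hc'A)
    have g3 : Real.exp ((Ls part A (part c')).card * -(η * p)) ≤ Real.exp (-(η * θ)) := by
      apply Real.exp_le_exp.2; nlinarith
    refine g3.trans ?_
    have hθ0 : 0 < θ := by linarith
    have g4 := exp_quad (y := -(η * θ)) (by
      rw [abs_neg, abs_of_nonneg (by positivity)]; nlinarith [h.hθ1])
    nlinarith [h.hθ1, mul_pos h3 h3, mul_pos h3 hθ0, mul_nonneg h3.le (sub_nonneg.2 h.hθ1)]
  have hb1 : (t + 1 : ℕ) * (η * p) ≤ 1 / 2 := by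
    have : (t : ℝ) ≤ (Nb H A c).card := by
      exact_mod_cast Finset.card_le_card Finset.inter_subset_left
    have g1 := hst.hM c hc
    have g2 : p * t ≤ M := (mul_le_mul_of_nonneg_left this hp.le).trans g1
    have g3 := h.hηM
    push_cast
    nlinarith
  have hb : 1 ≤ q ^ (t + 1) * (1 + 4 * (η * p) * (t + 1)) := by
    have g1 := one_add_mul_le_pow (a := -(η * p)) (by linarith) (t + 1)
    have g2 : 1 - (t + 1 : ℕ) * (η * p) ≤ q ^ (t + 1) := by
      rw [hq, sub_eq_add_neg 1 (η * p)]; linarith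
    have g4 : (0:ℝ) ≤ (t + 1 : ℕ) * (η * p) := by positivity
    have g3 : (1:ℝ) + 4 * (η * p) * (t + 1) = 1 + 4 * ((t + 1 : ℕ) * (η * p)) := by push_cast; ring
    rw [g3]
    refine le_trans ?_ (mul_le_mul_of_nonneg_right g2 (by linarith))
    nlinarith
  have k1 := rpi_fa (H := H) h hc
  have k2 := rpi_fa (H := H) h hc'A
  rw [← hq] at k1 k2
  have z1 : 0 ≤ 1 - rpi H A η p M (Ix.fa c) := by linarith [(rpi_prob h hst (Ix.fa c)).2]
  have z2 : 0 ≤ 1 - rpi H A η p M (Ix.fa c') := by linarith [(rpi_prob h hst (Ix.fa c')).2]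
  rw [hprod]
  set r1 := 1 - rpi H A η p M (Ix.fa c)
  set r2 := 1 - rpi H A η p M (Ix.fa c')
  have m1 : q ^ (U.card + (t + 1)) ≤
      q ^ ((Nb H A c).card + (Nb H A c').card + (Ls part A (part c')).card) :=
    pow_le_pow_of_le_one hq0.le hq1 hcard
  have m2 : r1 * (r2 * q ^ U.card) * q ^ (t + 1) ≤ KK η M ^ 2 * (1 - η / 2) := by
    calc r1 * (r2 * q ^ U.card) * q ^ (t + 1) = (r1 * r2) * q ^ (U.card + (t + 1)) := by
          rw [pow_add]; ring
      _ ≤ (r1 * r2) * q ^ ((Nb H A c).card + (Nb H A c').card + (Ls part A (part c')).card) :=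
          mul_le_mul_of_nonneg_left m1 (mul_nonneg z1 z2)
      _ = (r1 * q ^ (Nb H A c).card) * (r2 * q ^ (Nb H A c').card) *
            q ^ (Ls part A (part c')).card := by rw [pow_add, pow_add]; ring
      _ = KK η M ^ 2 * q ^ (Ls part A (part c')).card := by rw [k1, k2]; ring
      _ ≤ _ := mul_le_mul_of_nonneg_left hL (sq_nonneg _)
  have n0 : 0 ≤ r1 * (r2 * q ^ U.card) := by positivity
  have n1 : (0:ℝ) ≤ 1 + 4 * (η * p) * (t + 1) := by positivity
  calc r1 * (r2 * q ^ U.card) = r1 * (r2 * q ^ U.card) * 1 := by ring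
    _ ≤ r1 * (r2 * q ^ U.card) * (q ^ (t + 1) * (1 + 4 * (η * p) * (t + 1))) :=
        mul_le_mul_of_nonneg_left hb n0
    _ = r1 * (r2 * q ^ U.card) * q ^ (t + 1) * (1 + 4 * (η * p) * (t + 1)) := by ring
    _ ≤ KK η M ^ 2 * (1 - η / 2) * (1 + 4 * (η * p) * (t + 1)) := mul_le_mul_of_nonneg_right m2 n1
    _ = _ := by ring

theorem f2_arith {K D n : ℝ} (hp : 0 < p) (hM : 0 < M) (h3 : 0 < η) (h2 : η ≤ 1) (hK : 0 < K)
    (hk0 : 0 ≤ k) (hD0 : 0 ≤ D) (hn0 : 0 ≤ n) (hD : p * (p * D) ≤ 2 * M) (hL : p * n ≤ 2) :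
    (p / K) ^ 2 * (K ^ 2 * ((1 - η / 2) * (D + 4 * (η * p) * (D + n * (2 * k))))) ≤
      (1 - η / 2) * (p * (p * D)) + (8 * η * p * M + 16 * η * k * p ^ 2) := by
  have e : (p / K) ^ 2 * (K ^ 2 * ((1 - η / 2) * (D + 4 * (η * p) * (D + n * (2 * k))))) =
      (1 - η / 2) * (p * (p * D)) +
        (1 - η / 2) * (4 * (η * p) * (p * (p * D) + p * (p * n) * (2 * k))) := by
    field_simp
  rw [e]
  have g1 : p * (p * D) + p * (p * n) * (2 * k) ≤ 2 * M + p * 2 * (2 * k) := by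
    apply add_le_add hD
    apply mul_le_mul_of_nonneg_right _ (by positivity)
    exact mul_le_mul_of_nonneg_left hL hp.le
  have g2 : 4 * (η * p) * (p * (p * D) + p * (p * n) * (2 * k)) ≤
      4 * (η * p) * (2 * M + p * 2 * (2 * k)) :=
    mul_le_mul_of_nonneg_left g1 (by positivity)
  have g3 : 0 ≤ 4 * (η * p) * (p * (p * D) + p * (p * n) * (2 * k)) := by positivity
  have g4 := mul_nonneg h3.le g3
  linarith

theorem f2_mean (h : RPar p M θ a η) (hst : State H part W A p M θ a) (hn : Nice H part d A)
    (hk : ∀ c ∈ A, ∑ c' ∈ Nb H A c, ((Nb H A c ∩ Nb H A c').card : ℝ) ≤ 2 * k) (hk0 : 0 ≤ k)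
    {v : V} (hv : v ∈ W) :
    EE (rpi H A η p M) univ (cnt ((p / KK η M) ^ 2) (Tv H part A v) (Fam H part A)) ≤
      (1 - η / 2) * (p * (p * ∑ c ∈ Ls part A v, ((Nb H A c).card : ℝ))) +
        (8 * η * p * M + 16 * η * k * p ^ 2) := by
  have hp := h.hp
  have hM := h.hM
  have h2 := h.hη1; have h3 := h.hη
  have hK := KK_pos (η := η) (M := M)
  rw [EE_cnt]
  have h1 : ∑ j ∈ Tv H part A v, ∏ i ∈ Fam H part A j, (1 - rpi H A η p M i) ≤
      KK η M ^ 2 * ((1 - η / 2) * (∑ c ∈ Ls part A v, ((Nb H A c).card : ℝ) + 4 * (η * p) *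
        (∑ c ∈ Ls part A v, ((Nb H A c).card : ℝ) + (Ls part A v).card * (2 * k)))) := by
    rw [sum_Tv]
    calc ∑ c ∈ Ls part A v, ∑ c' ∈ Nb H A c, ∏ i ∈ Fam H part A ⟨c, c'⟩, (1 - rpi H A η p M i)
        ≤ ∑ c ∈ Ls part A v, ∑ c' ∈ Nb H A c, KK η M ^ 2 * ((1 - η / 2) *
          (1 + 4 * (η * p) * ((Nb H A c ∩ Nb H A c').card + 1))) :=
          Finset.sum_le_sum fun c hc => Finset.sum_le_sum fun c' hc' =>
            fam_prod h hst hn (mem_Ls.1 hc).1 hc'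
      _ = KK η M ^ 2 * ((1 - η / 2) * (∑ c ∈ Ls part A v, ((Nb H A c).card : ℝ) + 4 * (η * p) *
        (∑ c ∈ Ls part A v, ((Nb H A c).card : ℝ) +
          ∑ c ∈ Ls part A v, ∑ c' ∈ Nb H A c, ((Nb H A c ∩ Nb H A c').card : ℝ)))) := by
          simp only [← Finset.mul_sum, Finset.sum_add_distrib, Finset.sum_const, nsmul_eq_mul,
            mul_one]
          ring
      _ ≤ _ := by
          apply mul_le_mul_of_nonneg_left _ (sq_nonneg _)
          apply mul_le_mul_of_nonneg_left _ (by linarith)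
          apply add_le_add_right
          apply mul_le_mul_of_nonneg_left _ (by positivity)
          apply add_le_add_right
          rw [← nsmul_eq_mul]
          exact Finset.sum_le_card_nsmul _ _ _ fun c hc => hk c (mem_Ls.1 hc).1
  refine (mul_le_mul_of_nonneg_left h1 (sq_nonneg _)).trans ?_
  exact f2_arith hp hM h3 h2 hK hk0 (Finset.sum_nonneg fun _ _ => Nat.cast_nonneg _)
    (Nat.cast_nonneg _) (pair_card hst hp hM h.ha hv) ((hst.ha v hv).trans h.ha)

end round2


set_option linter.unusedSectionVars false
set_option linter.unusedVariables false
section round3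
variable {V C : Type} [Fintype C] {H : SimpleGraph C} {part : C → V}
variable {A : Finset C} {d : ℝ} {W : Finset V} {p M θ a η k : ℝ}

def za (H : SimpleGraph C) (part : C → V) (A : Finset C) (w : ℝ) (v : V) : Ix C → ℝ
  | Ix.tr x => w * ∑ c ∈ Ls part A v, ∑ c' ∈ Nb H A c, ind (x ∈ A ∧ part c' = part x)
  | Ix.fa _ => 0

def NN (H : SimpleGraph C) (A : Finset C) : Ix C → Finset (Ix C)
  | Ix.tr x => if x ∈ A then TT (Nb H A x) else ∅
  | Ix.fa _ => ∅

theorem sum_Ix (f : Ix C → ℝ) (hfa : ∀ x, f (Ix.fa x) = 0) (htr : ∀ x, x ∉ A → f (Ix.tr x) = 0) :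
    ∑ i, f i = ∑ x ∈ A, f (Ix.tr x) := by
  rw [← sum_TT]
  symm
  apply Finset.sum_subset (Finset.subset_univ _)
  intro i _ hi
  cases i with
  | fa x => exact hfa x
  | tr x => exact htr x fun h => hi (tr_mem_TT.2 h)

theorem za_tr_notMem {w : ℝ} {v : V} {x : C} (hx : x ∉ A) : za H part A w v (Ix.tr x) = 0 := by
  simp only [za]
  rw [Finset.sum_eq_zero, mul_zero]
  intro c _
  apply Finset.sum_eq_zero
  intro c' _
  exact ind_neg fun h => hx h.1

theorem za_nonneg {w : ℝ} (hw : 0 ≤ w) (v : V) (i : Ix C) : 0 ≤ za H part A w v i := by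
  cases i with
  | fa x => exact le_rfl
  | tr x =>
    exact mul_nonneg hw (Finset.sum_nonneg fun c _ => Finset.sum_nonneg fun c' _ => ind_nonneg _)

theorem NN_symm (x y : Ix C) : y ∈ NN H A x ↔ x ∈ NN H A y := by
  cases x with
  | fa x =>
    cases y with
    | fa y => simp [NN]
    | tr y =>
      simp only [NN]
      split_ifs <;> simp [fa_mem_TT]
  | tr x =>
    cases y with
    | fa y =>
      simp only [NN]
      split_ifs <;> simp [fa_mem_TT]
    | tr y =>
      simp only [NN]
      by_cases hx : x ∈ A <;> by_cases hy : y ∈ A <;>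
        simp [hx, hy, tr_mem_TT, mem_Nb, H.adj_comm x y]

theorem NN_irr (x : Ix C) : x ∉ NN H A x := by
  cases x with
  | fa x => simp [NN]
  | tr x =>
    simp only [NN]
    split_ifs
    · rw [tr_mem_TT, mem_Nb]; exact fun h => H.loopless.irrefl x h.2
    · simp

theorem za_le (h : RPar p M θ a η) (hst : State H part W A p M θ a) (hn : Nice H part d A)
    {v : V} (hv : v ∈ W) (i : Ix C) : za H part A ((p / KK η M) ^ 2) v i ≤ 8 * p := by
  have hp := h.hp
  cases i with
  | fa x => simp only [za]; positivity
  | tr x =>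
    simp only [za]
    have h1 := count_third hn v (fun u => x ∈ A ∧ u = part x) (by
      rintro u w ⟨_, rfl⟩ ⟨_, rfl⟩; rfl)
    have h2 : (p / KK η M) ^ 2 * ∑ c ∈ Ls part A v, ∑ c' ∈ Nb H A c, ind (x ∈ A ∧ part c' = part x)
        ≤ 4 * p ^ 2 * (Ls part A v).card :=
      mul_le_mul (pK_sq_le h) h1 (Finset.sum_nonneg fun c _ =>
        Finset.sum_nonneg fun c' _ => ind_nonneg _) (by positivity)
    have h3 := (hst.ha v hv).trans h.ha
    refine h2.trans ?_
    have := mul_le_mul_of_nonneg_left h3 (by positivity : 0 ≤ 4 * p)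
    nlinarith

theorem za_sum (h : RPar p M θ a η) (hst : State H part W A p M θ a) 
    {v : V} (hv : v ∈ W) : p * ∑ x ∈ A, za H part A ((p / KK η M) ^ 2) v (Ix.tr x) ≤ 16 * M := by
  have hp := h.hp
  simp only [za]
  rw [← Finset.mul_sum, Finset.sum_comm]
  have h1 : p * ∑ c ∈ Ls part A v, ∑ x ∈ A, ∑ c' ∈ Nb H A c, ind (x ∈ A ∧ part c' = part x) ≤
      2 * ∑ c ∈ Ls part A v, ((Nb H A c).card : ℝ) := by
    rw [Finset.mul_sum, Finset.mul_sum]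
    apply Finset.sum_le_sum
    intro c _
    rw [Finset.sum_comm, Finset.mul_sum]
    have : ∀ c' ∈ Nb H A c, p * ∑ x ∈ A, ind (x ∈ A ∧ part c' = part x) ≤ 2 := by
      intro c' hc'
      have e : ∑ x ∈ A, ind (x ∈ A ∧ part c' = part x) = (Ls part A (part c')).card := by
        rw [Finset.card_eq_sum_ones, Nat.cast_sum]
        unfold Ls
        rw [Finset.sum_filter]
        apply Finset.sum_congr rfl
        intro x hx
        by_cases hh : part c' = part x
        · simp [ind, hx, hh]
        · have : ¬ part x = part c' := fun e => hh e.symm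
          simp [ind, hh, this]
      rw [e]
      exact (hst.ha _ (hst.hAW _ (mem_Nb.1 hc').1)).trans h.ha
    have := Finset.sum_le_card_nsmul _ _ _ this
    rw [nsmul_eq_mul] at this
    linarith
  have h3 := pair_card hst hp h.hM h.ha hv
  have h4 : 0 ≤ ∑ c ∈ Ls part A v, ((Nb H A c).card : ℝ) :=
    Finset.sum_nonneg fun _ _ => Nat.cast_nonneg _
  calc _ = (p / KK η M) ^ 2 * (p * ∑ c ∈ Ls part A v, ∑ x ∈ A, ∑ c' ∈ Nb H A c,
        ind (x ∈ A ∧ part c' = part x)) := by ring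
    _ ≤ (p / KK η M) ^ 2 * (2 * ∑ c ∈ Ls part A v, ((Nb H A c).card : ℝ)) :=
        mul_le_mul_of_nonneg_left h1 (sq_nonneg _)
    _ ≤ 4 * p ^ 2 * (2 * ∑ c ∈ Ls part A v, ((Nb H A c).card : ℝ)) :=
        mul_le_mul_of_nonneg_right (pK_sq_le h) (by positivity)
    _ ≤ 16 * M := by nlinarith

theorem Z_tail (h : RPar p M θ a η) (hst : State H part W A p M θ a) (hn : Nice H part d A)
    {v : V} (hv : v ∈ W) :
    PP (rpi H A η p M) univ (fun S => 512 * η ^ 2 * M ^ 2 ≤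
      ZZ (za H part A ((p / KK η M) ^ 2) v) (NN H A) S) ≤ Real.exp (-(8 * η ^ 2 * M ^ 2 / p)) := by
  have hp := h.hp
  have hη := h.hη
  have hM := h.hM
  have ha := za_le h hst hn hv
  have ha0 := za_nonneg (H := H) (part := part) (A := A) (sq_nonneg (p / KK η M)) v
  set w := (p / KK η M) ^ 2 with hw
  have hl : 32 * p * (1 / (32 * p)) = 1 := by field_simp
  have hl0 : 0 < 1 / (32 * p) := by positivity
  refine (ZZ_tail (rpi_prob h hst) (za H part A w v) (NN H A) ha0 NN_symm NN_irr
    (1 / (32 * p)) hl0.le ?_ ?_ (m := 16 * η ^ 2 * M ^ 2) ?_ (512 * η ^ 2 * M ^ 2)).trans ?_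
  · intro x
    have := mul_le_mul_of_nonneg_left (ha x) hl0.le
    nlinarith
  · intro y
    have hs : ∑ x ∈ NN H A y, rpi H A η p M x * za H part A w v x ≤ 8 * η * p * M := by
      cases y with
      | fa y => simp only [NN, Finset.sum_empty]; positivity
      | tr y =>
        simp only [NN]
        split_ifs with hy
        · rw [sum_TT]
          have : ∀ x ∈ Nb H A y, rpi H A η p M (Ix.tr x) * za H part A w v (Ix.tr x) ≤
              η * p * (8 * p) := by
            intro x _
            simp only [rpi]
            exact mul_le_mul_of_nonneg_left (ha _) (by positivity)
          refine (Finset.sum_le_card_nsmul _ _ _ this).trans ?_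
          rw [nsmul_eq_mul]
          have := mul_le_mul_of_nonneg_left (hst.hM y hy) (by positivity : 0 ≤ 8 * η * p)
          nlinarith
        · rw [Finset.sum_empty]; positivity
    have h1 := mul_le_mul_of_nonneg_left hs hl0.le
    have h2 : 1 / (32 * p) * (8 * η * p * M) = η * M / 4 := by field_simp; norm_num
    have := h.hηM
    nlinarith
  · rw [sum_Ix (A := A)]
    · have : ∀ x ∈ A, ∑ y ∈ NN H A (Ix.tr x), rpi H A η p M (Ix.tr x) * rpi H A η p M y *
          za H part A w v (Ix.tr x) ≤ η ^ 2 * M * (p * za H part A w v (Ix.tr x)) := by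
        intro x hx
        simp only [NN, hx, if_true]
        rw [sum_TT]
        simp only [rpi, Finset.sum_const, nsmul_eq_mul]
        have h1 := mul_le_mul_of_nonneg_right (hst.hM x hx) (ha0 (Ix.tr x))
        have h2 := mul_le_mul_of_nonneg_left h1 (by positivity : 0 ≤ η ^ 2 * p)
        nlinarith
      refine (Finset.sum_le_sum this).trans ?_
      rw [← Finset.mul_sum, ← Finset.mul_sum]
      have := mul_le_mul_of_nonneg_left (za_sum h hst hv) (by positivity : 0 ≤ η ^ 2 * M)
      rw [← hw] at this
      nlinarith
    · intro x; simp [NN]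
    · intro x hx; simp [NN, hx]
  · apply Real.exp_le_exp.2
    apply le_of_eq
    field_simp
    ring

end round3


set_option linter.unusedSectionVars false
set_option linter.unusedVariables false
section round4
variable {V C : Type} [Fintype C] {H : SimpleGraph C} {part : C → V}
variable {A : Finset C} {d : ℝ} {W : Finset V} {p M θ a η k ε : ℝ}

def col (H : SimpleGraph C) (part : C → V) (A : Finset C) (S : Finset (Ix C)) (v : V) : Prop :=
  ∃ x ∈ Ls part A v, good H A S x

def W1 (H : SimpleGraph C) (part : C → V) (A : Finset C) (W : Finset V) (S : Finset (Ix C)) :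
    Finset V := W.filter fun v => ¬ col H part A S v

def A1 (H : SimpleGraph C) (part : C → V) (A : Finset C) (S : Finset (Ix C)) : Finset C :=
  A.filter fun c => Disjoint (Blk H A c) S ∧ ¬ col H part A S (part c)

def A2 (H : SimpleGraph C) (part : C → V) (A : Finset C) (S : Finset (Ix C)) (p' M' : ℝ) :
    Finset C :=
  (A1 H part A S).filter fun c => p' * (Nb H (A1 H part A S) c).card ≤ M'

theorem mem_A1 {S : Finset (Ix C)} {c : C} : c ∈ A1 H part A S ↔
    c ∈ A ∧ Disjoint (Blk H A c) S ∧ ¬ col H part A S (part c) := by simp [A1]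

theorem mem_A2 {S : Finset (Ix C)} {c : C} {p' M' : ℝ} : c ∈ A2 H part A S p' M' ↔
    c ∈ A1 H part A S ∧ p' * (Nb H (A1 H part A S) c).card ≤ M' := by simp [A2]

theorem A2_sub {S : Finset (Ix C)} {p' M' : ℝ} : A2 H part A S p' M' ⊆ A :=
  fun c hc => (mem_A1.1 (mem_A2.1 hc).1).1

theorem Nb_mono {A B : Finset C} (h : A ⊆ B) (c : C) : Nb H A c ⊆ Nb H B c :=
  Finset.filter_subset_filter _ h

theorem Ls_mono {A B : Finset C} (h : A ⊆ B) (v : V) : Ls part A v ⊆ Ls part B v :=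
  Finset.filter_subset_filter _ h

theorem round_color {S : Finset (Ix C)} {p' M' : ℝ}
    (h : Colorable H part (W1 H part A W S) (A2 H part A S p' M')) : Colorable H part W A := by
  obtain ⟨X, hXA, hcov, hind⟩ := h
  have key : ∀ x ∈ X, ∀ y, good H A S y → y ∈ A → ¬ H.Adj x y := by
    intro x hx y hy hyA hadj
    have h1 := (mem_A1.1 (mem_A2.1 (hXA hx)).1).2.1
    exact Finset.disjoint_left.1 h1
      (Finset.mem_insert_of_mem (tr_mem_TT.2 (mem_Nb.2 ⟨hyA, hadj⟩))) hy.1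
  refine ⟨X ∪ A.filter (fun x => good H A S x), ?_, ?_, ?_⟩
  · exact Finset.union_subset (hXA.trans A2_sub) (Finset.filter_subset _ _)
  · intro v hv
    by_cases hc : col H part A S v
    · obtain ⟨x, hx, hg⟩ := hc
      rw [mem_Ls] at hx
      exact ⟨x, Finset.mem_union_right _ (Finset.mem_filter.2 ⟨hx.1, hg⟩), hx.2⟩
    · obtain ⟨x, hx, h2⟩ := hcov v (Finset.mem_filter.2 ⟨hv, hc⟩)
      exact ⟨x, Finset.mem_union_left _ hx, h2⟩
  · intro x hx y hy
    rw [Finset.mem_union, Finset.mem_filter] at hx hy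
    rcases hx with hx | hx <;> rcases hy with hy | hy
    · exact hind x hx y hy
    · exact key x hx y hy.2 hy.1
    · exact fun h => key y hy x hx.2 hx.1 h.symm
    · exact good_nonadj hy.1 hx.2 hy.2.1

theorem Ls_A1 {S : Finset (Ix C)} {v : V} (hv : ¬ col H part A S v) (w : ℝ) :
    w * (Ls part (A1 H part A S) v).card = cnt w (Ls part A v) (Blk H A) S := by
  unfold cnt
  congr 1
  have : Ls part (A1 H part A S) v = (Ls part A v).filter fun c => Disjoint (Blk H A c) S := by
    ext c
    rw [mem_Ls, mem_A1, Finset.mem_filter, mem_Ls]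
    constructor
    · rintro ⟨⟨h1, h2, _⟩, h3⟩; exact ⟨⟨h1, h3⟩, h2⟩
    · rintro ⟨⟨h1, h3⟩, h2⟩; exact ⟨⟨h1, h2, h3 ▸ hv⟩, h3⟩
  rw [this, Finset.card_eq_sum_ones, Nat.cast_sum, Finset.sum_filter]
  apply Finset.sum_congr rfl
  intro c _
  by_cases h : Disjoint (Blk H A c) S <;> simp [ind, h]

theorem ZZ_eq (S : Finset (Ix C)) (v : V) (w : ℝ) :
    ZZ (za H part A w v) (NN H A) S = w * ∑ c ∈ Ls part A v, ∑ c' ∈ Nb H A c, ∑ x ∈ A,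
      ind (x ∈ A ∧ part c' = part x) * (ind (Ix.tr x ∈ S) * ind (∃ y ∈ NN H A (Ix.tr x), y ∈ S)) := by
  unfold ZZ
  rw [sum_Ix (A := A)]
  · simp only [za]
    simp only [Finset.mul_sum, Finset.sum_mul]
    rw [Finset.sum_comm]
    apply Finset.sum_congr rfl
    intro c _
    rw [Finset.sum_comm]
    apply Finset.sum_congr rfl
    intro c' _
    apply Finset.sum_congr rfl
    intro x _
    ring
  · intro x; simp [za]
  · intro x hx; rw [za_tr_notMem hx, zero_mul]

theorem pair_bound (S : Finset (Ix C)) (v : V) {w : ℝ} (hw : 0 ≤ w) :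
    w * ∑ c ∈ Ls part (A1 H part A S) v, ((Nb H (A1 H part A S) c).card : ℝ) ≤
      cnt w (Tv H part A v) (Fam H part A) S + ZZ (za H part A w v) (NN H A) S := by
  rw [ZZ_eq]
  unfold cnt
  rw [← mul_add]
  apply mul_le_mul_of_nonneg_left _ hw
  rw [sum_Tv, ← Finset.sum_add_distrib]
  have hsub : A1 H part A S ⊆ A := Finset.filter_subset _ _
  have hnn : ∀ c' : C, 0 ≤ ∑ x ∈ A, ind (x ∈ A ∧ part c' = part x) *
      (ind (Ix.tr x ∈ S) * ind (∃ y ∈ NN H A (Ix.tr x), y ∈ S)) := fun c' =>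
    Finset.sum_nonneg fun x _ => mul_nonneg (ind_nonneg _) (mul_nonneg (ind_nonneg _) (ind_nonneg _))
  refine le_trans ?_ (Finset.sum_le_sum_of_subset_of_nonneg (Ls_mono hsub v) ?_)
  · apply Finset.sum_le_sum
    intro c hc
    rw [← Finset.sum_add_distrib]
    refine le_trans ?_ (Finset.sum_le_sum_of_subset_of_nonneg (Nb_mono hsub c) ?_)
    · rw [Finset.card_eq_sum_ones, Nat.cast_sum]
      apply Finset.sum_le_sum
      intro c' hc'
      rw [Nat.cast_one]
      have hcA := (mem_A1.1 (mem_Ls.1 hc).1)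
      have hc'A := (mem_A1.1 (mem_Nb.1 hc').1)
      by_cases hd : Disjoint (Fam H part A ⟨c, c'⟩) S
      · rw [ind_pos hd]; linarith [hnn c']
      · have h1 : ¬ Disjoint (TT (Ls part A (part c'))) S := by
          intro h
          apply hd
          unfold Fam
          rw [Finset.disjoint_union_left, Finset.disjoint_union_left]
          exact ⟨hcA.2.1, hc'A.2.1, h⟩
        rw [Finset.not_disjoint_iff] at h1
        obtain ⟨i, hi, hiS⟩ := h1
        obtain ⟨x, hx, rfl⟩ := mem_TT.1 hi
        have hxA := mem_Ls.1 hx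
        have hg : ¬ good H A S x := fun hg => hc'A.2.2 ⟨x, hx, hg⟩
        have h2 : ¬ Disjoint (TT (Nb H A x)) S := fun h => hg ⟨hiS, h⟩
        rw [Finset.not_disjoint_iff] at h2
        have h3 : ∃ y ∈ NN H A (Ix.tr x), y ∈ S := by
          simp only [NN, hxA.1, if_true]; exact h2
        have h4 := Finset.single_le_sum (f := fun x => ind (x ∈ A ∧ part c' = part x) *
          (ind (Ix.tr x ∈ S) * ind (∃ y ∈ NN H A (Ix.tr x), y ∈ S)))
          (fun x _ => mul_nonneg (ind_nonneg _) (mul_nonneg (ind_nonneg _) (ind_nonneg _))) hxA.1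
        rw [ind_pos ⟨hxA.1, hxA.2.symm⟩, ind_pos hiS, ind_pos h3] at h4
        linarith [ind_nonneg (Disjoint (Fam H part A ⟨c, c'⟩) S)]
    · intro c' _ _
      exact add_nonneg (ind_nonneg _) (hnn c')
  · intro c _ _
    exact add_nonneg (Finset.sum_nonneg fun _ _ => ind_nonneg _) (Finset.sum_nonneg fun c' _ => hnn c')

/-- the bad event at a vertex -/
def Bad (H : SimpleGraph C) (part : C → V) (A : Finset C) (p M η ε : ℝ) (v : V)
    (S : Finset (Ix C)) : Prop :=
  (p * (Ls part A v).card + ε / 4 ≤ cnt (p / KK η M) (Ls part A v) (Blk H A) S ∨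
    cnt (p / KK η M) (Ls part A v) (Blk H A) S ≤ p * (Ls part A v).card - ε / 4) ∨
  (EE (rpi H A η p M) univ (cnt ((p / KK η M) ^ 2) (Tv H part A v) (Fam H part A)) + ε * M / 8 ≤
      cnt ((p / KK η M) ^ 2) (Tv H part A v) (Fam H part A) S ∨
    512 * η ^ 2 * M ^ 2 ≤ ZZ (za H part A ((p / KK η M) ^ 2) v) (NN H A) S)

theorem cnt_dep {J : Type} {w : ℝ} {T : Finset J} {F : J → Finset (Ix C)} {D S : Finset (Ix C)}
    {i : Ix C} (h : ∀ j ∈ T, F j ⊆ D) (hi : i ∉ D) : cnt w T F (insert i S) = cnt w T F S := by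
  unfold cnt
  congr 1
  apply Finset.sum_congr rfl
  intro j hj
  exact ind_congr (disj_insert_of (h j hj) hi)

theorem Blk_nbr {c : C} (hc : c ∈ A) {i : Ix C} (hi : i ∈ Blk H A c) : i.fst ∈ nbr H part A c := by
  unfold Blk at hi
  rw [Finset.mem_insert] at hi
  rcases hi with rfl | hi
  · exact nbr_self hc
  · obtain ⟨x, hx, rfl⟩ := mem_TT.1 hi
    exact nbr_Nb hx

theorem Bad_dep (v : V) : DepOn (DD H part A v) (Bad H part A p M η ε v) := by
  intro S i hi
  have h1 : cnt (p / KK η M) (Ls part A v) (Blk H A) (insert i S) =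
      cnt (p / KK η M) (Ls part A v) (Blk H A) S := by
    apply cnt_dep _ hi
    intro c hc j hj
    exact DD1 hc (Blk_nbr (mem_Ls.1 hc).1 hj) j rfl
  have h2 : cnt ((p / KK η M) ^ 2) (Tv H part A v) (Fam H part A) (insert i S) =
      cnt ((p / KK η M) ^ 2) (Tv H part A v) (Fam H part A) S := by
    apply cnt_dep _ hi
    rintro ⟨c, c'⟩ hc j hj
    unfold Tv at hc
    rw [Finset.mem_sigma] at hc
    obtain ⟨hc, hc'⟩ := hc
    simp only at hc hc'
    unfold Fam at hj
    rw [Finset.mem_union, Finset.mem_union] at hj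
    rcases hj with hj | hj | hj
    · exact DD1 hc (Blk_nbr (mem_Ls.1 hc).1 hj) j rfl
    · exact DD2 hc (nbr_Nb hc') (Blk_nbr (mem_Nb.1 hc').1 hj) j rfl
    · obtain ⟨x, hx, rfl⟩ := mem_TT.1 hj
      rw [mem_Ls] at hx
      exact DD2 hc (nbr_Nb hc') (mem_nbr.2 ⟨hx.1, Or.inr hx.2⟩) _ rfl
  have h3 : ZZ (za H part A ((p / KK η M) ^ 2) v) (NN H A) (insert i S) =
      ZZ (za H part A ((p / KK η M) ^ 2) v) (NN H A) S := by
    rw [ZZ_eq, ZZ_eq]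
    congr 1
    apply Finset.sum_congr rfl
    intro c hc
    apply Finset.sum_congr rfl
    intro c' hc'
    apply Finset.sum_congr rfl
    intro x hx
    by_cases hp : part c' = part x
    · have hxn : x ∈ nbr H part A c' := mem_nbr.2 ⟨hx, Or.inr hp.symm⟩
      have hne : i ≠ Ix.tr x := by
        rintro rfl
        exact hi (DD2 hc (nbr_Nb hc') hxn _ rfl)
      have e1 : Ix.tr x ∈ insert i S ↔ Ix.tr x ∈ S := by
        rw [Finset.mem_insert]
        exact ⟨fun h => h.resolve_left fun e => hne e.symm, Or.inr⟩
      have e2 : (∃ y ∈ NN H A (Ix.tr x), y ∈ insert i S) ↔ ∃ y ∈ NN H A (Ix.tr x), y ∈ S := by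
        simp only [NN, hx, if_true]
        constructor
        · rintro ⟨y, hy, hyS⟩
          refine ⟨y, hy, ?_⟩
          rw [Finset.mem_insert] at hyS
          refine hyS.resolve_left ?_
          rintro rfl
          obtain ⟨z, hz, rfl⟩ := mem_TT.1 hy
          exact hi (DD3 hc (nbr_Nb hc') hxn (nbr_Nb hz) _ rfl)
        · rintro ⟨y, hy, hyS⟩
          exact ⟨y, hy, Finset.mem_insert_of_mem hyS⟩
      rw [ind_congr e1, ind_congr e2]
    · rw [ind_neg (fun h : x ∈ A ∧ part c' = part x => hp h.2), zero_mul, zero_mul]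
  unfold Bad
  rw [h1, h2, h3]

theorem round_arith {l D q2 e1 z cn mean : ℝ} (hM : 0 < M) (hη : 0 < η) (hη1 : η ≤ 1)
    (hpot : θ * M ≤ M * l - D)
    (hl : l - ε / 4 ≤ q2) (hcn : cn ≤ mean + ε * M / 8) (hz : z ≤ 512 * η ^ 2 * M ^ 2)
    (hmean : mean ≤ (1 - η / 2) * D + e1)
    (herr : (1 - η / 2) * M * ε / 4 + ε * M / 8 + 512 * η ^ 2 * M ^ 2 + e1 ≤ ε * ((1 - η / 2) * M)) :
    (θ - ε) * ((1 - η / 2) * M) ≤ (1 - η / 2) * M * q2 - (cn + z) := by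
  have h0 : 0 ≤ 1 - η / 2 := by linarith
  have h1 := mul_le_mul_of_nonneg_left hpot h0
  have h2 := mul_le_mul_of_nonneg_left hl (mul_nonneg h0 hM.le)
  nlinarith

theorem round_state (h : RPar p M θ a η) (hst : State H part W A p M θ a) (hn : Nice H part d A)
    (hk : ∀ c ∈ A, ∑ c' ∈ Nb H A c, ((Nb H A c ∩ Nb H A c').card : ℝ) ≤ 2 * k) (hk0 : 0 ≤ k)
    (hε : 0 < ε)
    (herr : (1 - η / 2) * M * ε / 4 + ε * M / 8 + 512 * η ^ 2 * M ^ 2 +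
      (8 * η * p * M + 16 * η * k * p ^ 2) ≤ ε * ((1 - η / 2) * M))
    {S : Finset (Ix C)} (hS : ∀ v ∈ W, ¬ Bad H part A p M η ε v S) :
    State H part (W1 H part A W S) (A2 H part A S (p / KK η M) ((1 - η / 2) * M))
      (p / KK η M) ((1 - η / 2) * M) (θ - ε) (a + ε) := by
  have hp := h.hp
  have hK := KK_pos (η := η) (M := M)
  have hp' : 0 < p / KK η M := div_pos hp hK
  set p' := p / KK η M with hp'd
  set M' := (1 - η / 2) * M with hM'
  have hsub : A2 H part A S p' M' ⊆ A1 H part A S := Finset.filter_subset _ _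
  constructor
  · intro c hc
    have h1 := mem_A1.1 (hsub hc)
    exact Finset.mem_filter.2 ⟨hst.hAW c h1.1, h1.2.2⟩
  · intro v hv
    obtain ⟨hvW, hvc⟩ := Finset.mem_filter.1 hv
    have hb := hS v hvW
    unfold Bad at hb
    push Not at hb
    have h1 := hb.1.1
    rw [← hp'd, ← Ls_A1 hvc] at h1
    have h2 : ((Ls part (A2 H part A S p' M') v).card : ℝ) ≤ (Ls part (A1 H part A S) v).card := by
      exact_mod_cast Finset.card_le_card (Ls_mono hsub v)
    have h3 := mul_le_mul_of_nonneg_left h2 hp'.le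
    have h4 := hst.ha v hvW
    linarith
  · intro c hc
    have h1 := (mem_A2.1 hc).2
    refine le_trans ?_ h1
    apply mul_le_mul_of_nonneg_left _ hp'.le
    exact_mod_cast Finset.card_le_card (Nb_mono hsub c)
  · intro v hv
    obtain ⟨hvW, hvc⟩ := Finset.mem_filter.1 hv
    have hb := hS v hvW
    unfold Bad at hb
    push Not at hb
    rw [← hp'd] at hb
    have h1 := hb.1.2
    rw [← Ls_A1 hvc] at h1
    have hpot := hst.hθ v hvW
    have e1 : p * ∑ c ∈ Ls part A v, (M - p * (Nb H A c).card) =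
        M * (p * (Ls part A v).card) - p * (p * ∑ c ∈ Ls part A v, ((Nb H A c).card : ℝ)) := by
      rw [Finset.sum_sub_distrib, Finset.sum_const, nsmul_eq_mul, Finset.mul_sum _ _ p]
      ring
    rw [e1] at hpot
    have hm := f2_mean h hst hn hk hk0 hvW
    rw [← hp'd] at hm
    have h5 := round_arith h.hM h.hη h.hη1 hpot h1.le hb.2.1.le hb.2.2.le hm herr
    rw [← hM'] at h5
    have h6 := pair_bound (H := H) (part := part) (A := A) S v (sq_nonneg p')
    refine h5.trans ?_
    have h7 : p' * ∑ c ∈ Ls part (A1 H part A S) v, (M' - p' * (Nb H (A1 H part A S) c).card) =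
        M' * (p' * (Ls part (A1 H part A S) v).card) -
          p' ^ 2 * ∑ c ∈ Ls part (A1 H part A S) v, ((Nb H (A1 H part A S) c).card : ℝ) := by
      rw [Finset.sum_sub_distrib, Finset.sum_const, nsmul_eq_mul, ← Finset.mul_sum]
      ring
    have h8 : p' * ∑ c ∈ Ls part (A1 H part A S) v, (M' - p' * (Nb H (A1 H part A S) c).card) ≤
        p' * ∑ c ∈ Ls part (A2 H part A S p' M') v,
          (M' - p' * (Nb H (A2 H part A S p' M') c).card) := by
      apply mul_le_mul_of_nonneg_left _ hp'.le
      have g1 : ∑ c ∈ Ls part (A1 H part A S) v, (M' - p' * (Nb H (A1 H part A S) c).card) ≤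
          ∑ c ∈ Ls part (A2 H part A S p' M') v, (M' - p' * (Nb H (A1 H part A S) c).card) := by
        rw [← Finset.sum_sdiff (Ls_mono hsub v)]
        have : ∑ c ∈ Ls part (A1 H part A S) v \ Ls part (A2 H part A S p' M') v,
            (M' - p' * (Nb H (A1 H part A S) c).card) ≤ 0 := by
          apply Finset.sum_nonpos
          intro c hc
          rw [Finset.mem_sdiff, mem_Ls, mem_Ls] at hc
          have : ¬ p' * (Nb H (A1 H part A S) c).card ≤ M' := by
            intro hh
            exact hc.2 ⟨mem_A2.2 ⟨hc.1.1, hh⟩, hc.1.2⟩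
          linarith
        linarith
      refine g1.trans (Finset.sum_le_sum ?_)
      intro c _
      have h2 : ((Nb H (A2 H part A S p' M') c).card : ℝ) ≤ (Nb H (A1 H part A S) c).card := by
        exact_mod_cast Finset.card_le_card (Nb_mono hsub c)
      have := mul_le_mul_of_nonneg_left h2 hp'.le
      linarith
    linarith

theorem round_lemma (h : RPar p M θ a η) (hst : State H part W A p M θ a) (hn : Nice H part d A)
    (hk : ∀ c ∈ A, ∑ c' ∈ Nb H A c, ((Nb H A c ∩ Nb H A c').card : ℝ) ≤ 2 * k) (hk0 : 0 ≤ k)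
    (hε : 0 < ε) (hd : 1 ≤ d)
    (herr : (1 - η / 2) * M * ε / 4 + ε * M / 8 + 512 * η ^ 2 * M ^ 2 +
      (8 * η * p * M + 16 * η * k * p ^ 2) ≤ ε * ((1 - η / 2) * M)) (P1 : ℝ)
    (hP1 : Real.exp (-(ε / 4 / Real.sqrt (2 * p)) + 8) ≤ P1)
    (hP2 : Real.exp (-(ε * M / 8 / Real.sqrt (12 * p * (M + 1))) + 40 * M) ≤ P1)
    (hP3 : Real.exp (-(8 * η ^ 2 * M ^ 2 / p)) ≤ P1)
    (hL : 16 * P1 * (d * (2 * d) ^ 6) ≤ 1)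
    (hrec : ∀ (W' : Finset V) (A' : Finset C), A' ⊆ A →
      State H part W' A' (p / KK η M) ((1 - η / 2) * M) (θ - ε) (a + ε) →
      Colorable H part W' A') : Colorable H part W A := by
  have hP0 : 0 ≤ P1 := (Real.exp_pos _).le.trans hP3
  have hS : ∃ S, ∀ v ∈ W, ¬ Bad H part A p M η ε v S := by
    apply lll_local (rpi_prob h hst) hn hd W (Bad H part A p M η ε) (fun v _ => Bad_dep v) (4 * P1)
      (by linarith) _ (by linarith)
    intro v hv
    have hπ := rpi_prob h hst
    refine (PP_or hπ univ _ _).trans ?_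
    have a1 := PP_or hπ univ (fun S => p * (Ls part A v).card + ε / 4 ≤
      cnt (p / KK η M) (Ls part A v) (Blk H A) S)
      (fun S => cnt (p / KK η M) (Ls part A v) (Blk H A) S ≤ p * (Ls part A v).card - ε / 4)
    have a2 := PP_or hπ univ (fun S => EE (rpi H A η p M) univ
      (cnt ((p / KK η M) ^ 2) (Tv H part A v) (Fam H part A)) + ε * M / 8 ≤
      cnt ((p / KK η M) ^ 2) (Tv H part A v) (Fam H part A) S)
      (fun S => 512 * η ^ 2 * M ^ 2 ≤ ZZ (za H part A ((p / KK η M) ^ 2) v) (NN H A) S)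
    have b1 := f1_tail h hst hn hv (ε / 4)
    have b2 := f2_tail h hst hn hv (ε * M / 8)
    have b3 := Z_tail h hst hn hv
    linarith [b1.1, b1.2]
  obtain ⟨S, hS⟩ := hS
  exact round_color (hrec _ _ A2_sub (round_state h hst hn hk hk0 hε herr hS))

end round4


set_option linter.unusedSectionVars false
set_option linter.unusedVariables false

structure NPar (η ε d k Q M0 Mf μ P1 : ℝ) : Prop where
  hη : 0 < η
  hη1 : η ≤ 1 / 3
  hε : 0 < ε
  hQ : 0 < Q
  hMf : 0 < Mf
  hk0 : 0 ≤ k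
  hd : 1 ≤ d
  c1 : 12 * Q * (M0 + 1) ≤ 1
  c2 : η * M0 ≤ 1 / 4
  c3 : 512 * η ^ 2 * M0 ≤ ε / 8
  c4 : 8 * η * Q ≤ ε / 8
  c5 : 16 * η * k * Q ^ 2 ≤ ε * Mf / 4
  c6 : Real.exp (-(ε / 4 / Real.sqrt (2 * Q)) + 8) ≤ P1
  c7 : Real.exp (-(ε * Mf / 8 / Real.sqrt (12 * Q * (M0 + 1))) + 40 * M0) ≤ P1
  c8 : Real.exp (-(8 * η ^ 2 * Mf ^ 2 / Q)) ≤ P1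
  c9 : 16 * P1 * (d * (2 * d) ^ 6) ≤ 1
  hμ : 0 < μ
  hμQ : μ * Q ≤ 1 / 2
  hμM : μ * Mf ≤ 1 / 2
  hμL : 4 * Real.exp (-(μ / 4)) * (d * (2 * d) ^ 6) ≤ 1

theorem NPar.herr {η ε d k Q M0 Mf μ P1 p M : ℝ} (h : NPar η ε d k Q M0 Mf μ P1) (hp : 0 < p)
    (hpQ : p ≤ Q) (hM : Mf ≤ M) (hM0 : M ≤ M0) :
    (1 - η / 2) * M * ε / 4 + ε * M / 8 + 512 * η ^ 2 * M ^ 2 +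
      (8 * η * p * M + 16 * η * k * p ^ 2) ≤ ε * ((1 - η / 2) * M) := by
  have hη := h.hη
  have hε := h.hε
  have hMp : 0 < M := h.hMf.trans_le hM
  have hk0 := h.hk0
  have h1 : 512 * η ^ 2 * M ^ 2 ≤ ε / 8 * M := by
    have e1 : 512 * η ^ 2 * M ≤ 512 * η ^ 2 * M0 := mul_le_mul_of_nonneg_left hM0 (by positivity)
    have := mul_le_mul_of_nonneg_right (e1.trans h.c3) hMp.le
    linarith
  have h2 : 8 * η * p * M ≤ ε / 8 * M := by
    have e1 : 8 * η * p ≤ 8 * η * Q := mul_le_mul_of_nonneg_left hpQ (by positivity)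
    exact mul_le_mul_of_nonneg_right (e1.trans h.c4) hMp.le
  have h3 : 16 * η * k * p ^ 2 ≤ ε * M / 4 := by
    have e1 : 16 * η * k * p ^ 2 ≤ 16 * η * k * Q ^ 2 :=
      mul_le_mul_of_nonneg_left (pow_le_pow_left₀ hp.le hpQ 2) (by positivity)
    have e2 : ε * Mf ≤ ε * M := mul_le_mul_of_nonneg_left hM hε.le
    have := h.c5
    linarith
  have h4 : η * (ε * M) ≤ 1 / 3 * (ε * M) := mul_le_mul_of_nonneg_right h.hη1 (by positivity)
  nlinarith

theorem exp_div_mono {A B t s u v : ℝ} (hA : 0 ≤ A) (hAB : A ≤ B) (ht : 0 < t) (hts : t ≤ s)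
    (huv : u ≤ v) : Real.exp (-(B / t) + u) ≤ Real.exp (-(A / s) + v) := by
  apply Real.exp_le_exp.2
  have : A / s ≤ B / t := div_le_div₀ (hA.trans hAB) hAB ht hts
  linarith

section iter
variable {V C : Type} [Fintype C] {H : SimpleGraph C} {part : C → V}

theorem Nice.mono {A B : Finset C} {d : ℝ} (h : Nice H part d A) (hB : B ⊆ A) :
    Nice H part d B := by
  refine ⟨h.indep, h.matching, fun c => ?_, fun v => ?_⟩
  · refine le_trans ?_ (h.deg c)
    exact_mod_cast Finset.card_le_card (Nb_mono hB c)
  · refine le_trans ?_ (h.size v)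
    exact_mod_cast Finset.card_le_card (Ls_mono hB v)

theorem iter {η ε d k Q M0 Mf μ P1 : ℝ} (h : NPar η ε d k Q M0 Mf μ P1)
    (hk : ∀ A : Finset C, ∀ c ∈ A, ∑ c' ∈ Nb H A c, ((Nb H A c ∩ Nb H A c').card : ℝ) ≤ 2 * k)
    (n : ℕ) : ∀ (W : Finset V) (A : Finset C) (M θ a : ℝ), Nice H part d A → 0 < M → M ≤ M0 →
      (1 - η / 2) ^ n * M ≤ Mf → θ ≤ 1 → 1 / 2 + η + n * ε ≤ θ → a ≤ 2 - n * ε →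
      State H part W A (Q * Real.exp (-(2 * (1 + η) * M))) M θ a → Colorable H part W A := by
  have hη := h.hη
  have hε := h.hε
  have hQ := h.hQ
  have hη1 := h.hη1
  have hpQ : ∀ M : ℝ, 0 < M → Q * Real.exp (-(2 * (1 + η) * M)) ≤ Q := by
    intro M hM
    have : Real.exp (-(2 * (1 + η) * M)) ≤ 1 := by
      apply Real.exp_le_one_iff.2
      have : 0 < 2 * (1 + η) * M := by positivity
      linarith
    nlinarith
  have hfin : ∀ (n : ℕ) (W : Finset V) (A : Finset C) (M θ a : ℝ), Nice H part d A → 0 < M →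
      M ≤ Mf → 1 / 2 + η + n * ε ≤ θ → 
      State H part W A (Q * Real.exp (-(2 * (1 + η) * M))) M θ a → Colorable H part W A := by
    intro n W A M θ a hn hM hMf hθ hst
    have hnε : 0 ≤ n * ε := by positivity
    refine final_color hn h.hd hst (by positivity) hM (by linarith) h.hμ ?_ ?_ h.hμL
    · exact (mul_le_mul_of_nonneg_left (hpQ M hM) h.hμ.le).trans h.hμQ
    · exact (mul_le_mul_of_nonneg_left hMf h.hμ.le).trans h.hμM
  induction n with
  | zero =>
    intro W A M θ a hn hM hM0 hMf hθ1 hθ ha hst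
    rw [pow_zero, one_mul] at hMf
    exact hfin 0 W A M θ a hn hM hMf hθ hst
  | succ n ih =>
    intro W A M θ a hn hM hM0 hMf hθ1 hθ ha hst
    by_cases hMM : M ≤ Mf
    · exact hfin (n + 1) W A M θ a hn hM hMM hθ hst
    push Not at hMM
    have hnε : 0 ≤ n * ε := by positivity
    push_cast at hθ ha
    have hp : 0 < Q * Real.exp (-(2 * (1 + η) * M)) := by positivity
    have hpq := hpQ M hM
    set p := Q * Real.exp (-(2 * (1 + η) * M)) with hpd
    have hpM : 12 * p * (M + 1) ≤ 12 * Q * (M0 + 1) := by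
      apply mul_le_mul <;> first | linarith | positivity
    have hR : RPar p M θ a η := by
      refine ⟨hp, hM, hpM.trans h.c1, hη, by linarith, ?_, hθ1, by linarith, by linarith⟩
      exact (mul_le_mul_of_nonneg_left hM0 hη.le).trans h.c2
    refine round_lemma hR hst hn (hk A) h.hk0 hε h.hd (h.herr hp hpq hMM.le hM0) P1 ?_ ?_ ?_ h.c9 ?_
    · refine le_trans ?_ h.c6
      apply exp_div_mono (by positivity) le_rfl (by positivity) _ le_rfl
      exact Real.sqrt_le_sqrt (by linarith)
    · refine le_trans ?_ h.c7
      have := h.hMf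
      apply exp_div_mono (by positivity) _ (by positivity) _ (by linarith)
      · have := mul_le_mul_of_nonneg_left hMM.le hε.le
        linarith
      · exact Real.sqrt_le_sqrt hpM
    · refine le_trans ?_ h.c8
      apply Real.exp_le_exp.2
      have hmf := h.hMf
      apply neg_le_neg
      apply div_le_div₀ (by positivity) _ hp hpq
      apply mul_le_mul_of_nonneg_left _ (by positivity)
      exact pow_le_pow_left₀ hmf.le hMM.le 2
    · intro W' A' hA' hst'
      have e : p / KK η M = Q * Real.exp (-(2 * (1 + η) * ((1 - η / 2) * M))) := by
        rw [hpd]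
        unfold KK
        rw [mul_div_assoc, ← Real.exp_sub]
        congr 2
        ring
      rw [e] at hst'
      refine ih W' A' _ (θ - ε) (a + ε) (hn.mono hA') ?_ ?_ ?_ ?_ ?_ ?_ hst'
      · apply mul_pos _ hM; linarith
      · have : 0 < η * M := by positivity
        nlinarith
      · rw [← mul_assoc, ← pow_succ]; exact hMf
      · linarith
      · linarith
      · linarith

end iter


set_option linter.unusedSectionVars false
set_option linter.unusedVariables false

theorem sqrt_le_u {u y : ℝ} (hu : 0 < u) (h : y ≤ u ^ 28) : Real.sqrt y ≤ u ^ 14 := by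
  refine Real.sqrt_le_iff.2 ⟨by positivity, ?_⟩
  rw [← pow_mul]; exact h

theorem exp_tail_le {B s w X : ℝ} (hs : 0 < s) (h : (w + X) * s ≤ B) :
    Real.exp (-(B / s) + w) ≤ Real.exp (-X) := by
  apply Real.exp_le_exp.2
  have := (le_div_iff₀ hs).2 h
  linarith

theorem num_aux {L Q M0 k d u : ℝ} (hL : 10 ^ 6 ≤ L) (hu : u * L = 1) (hd : d = Real.exp L)
    (hQ0 : 0 < Q)
    (hQ : Q ≤ u ^ 30) (hkQ : k * Q ^ 2 ≤ u ^ 60) (hM0 : 0 ≤ M0) (hM0L : M0 ≤ L) (hk0 : 0 ≤ k) :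
    NPar (u ^ 4) (u ^ 5) d k Q M0 (u / 200) (100 * L) (Real.exp (-(20 * L))) := by
  have hLp : 0 < L := by linarith
  have hup : 0 < u := by
    by_contra h
    push Not at h
    nlinarith
  have hu6 : u ≤ 1 / 10 ^ 6 := by
    rw [le_div_iff₀ (by norm_num)]
    nlinarith
  have hu1 : u ≤ 1 := by linarith
  have hstep : ∀ n : ℕ, u ^ (n + 1) ≤ u ^ n / 10 ^ 6 := by
    intro n
    rw [pow_succ]
    have : 0 < u ^ n := by positivity
    nlinarith
  have hmono : ∀ m n : ℕ, m ≤ n → u ^ n ≤ u ^ m := fun m n h =>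
    pow_le_pow_of_le_one hup.le hu1 h
  have hp : ∀ n : ℕ, 0 < u ^ n := fun n => by positivity
  have hLu : ∀ n : ℕ, L * u ^ (n + 1) = u ^ n := by
    intro n
    rw [pow_succ]
    linear_combination u ^ n * hu
  have hexp1 : 1024 * Real.exp (-(13 * L)) ≤ 1 := by
    have h1 : 13 * L + 1 ≤ Real.exp (13 * L) := Real.add_one_le_exp _
    rw [Real.exp_neg, ← div_eq_mul_inv, div_le_one (Real.exp_pos _)]
    linarith
  have hd7 : d * (2 * d) ^ 6 = 64 * Real.exp (7 * L) := by
    rw [hd, mul_pow, ← Real.exp_nat_mul, mul_left_comm, ← Real.exp_add]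
    norm_num
    ring_nf
  have hM1 : M0 + 1 ≤ 2 * L := by linarith
  have hb1 : 12 * Q * (M0 + 1) ≤ 24 * u ^ 29 := by
    have : 12 * Q * (M0 + 1) ≤ 12 * u ^ 30 * (2 * L) := by
      apply mul_le_mul _ hM1 (by linarith) (by positivity)
      linarith
    have h2 : L * u ^ 30 = u ^ 29 := hLu 29
    linarith
  have h29 : 24 * u ^ 29 ≤ u ^ 28 := by linarith [hstep 28, hp 28]
  refine ⟨by positivity, ?_, by positivity, hQ0, by positivity, hk0, ?_, ?_, ?_, ?_, ?_, ?_, ?_, ?_,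
    ?_, ?_, by positivity, ?_, ?_, ?_⟩
  · have := hmono 1 4 (by norm_num); linarith
  · rw [hd]; linarith [Real.add_one_le_exp L]
  · have := hmono 1 28 (by norm_num); linarith
  · have : u ^ 4 * M0 ≤ u ^ 4 * L := mul_le_mul_of_nonneg_left hM0L (hp 4).le
    have h2 : L * u ^ 4 = u ^ 3 := hLu 3
    have := hmono 1 3 (by norm_num)
    linarith
  · have : (u ^ 4) ^ 2 * M0 ≤ (u ^ 4) ^ 2 * L := mul_le_mul_of_nonneg_left hM0L (by positivity)
    have e : (u ^ 4) ^ 2 = u ^ 8 := by ring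
    rw [e] at this ⊢
    have h2 : L * u ^ 8 = u ^ 7 := hLu 7
    have := hmono 6 7 (by norm_num)
    have : u ^ 6 ≤ u ^ 5 / 10 ^ 6 := hstep 5
    linarith [hp 5]
  · have : u ^ 4 * Q ≤ u ^ 4 * u ^ 30 := mul_le_mul_of_nonneg_left hQ (hp 4).le
    have e : u ^ 4 * u ^ 30 = u ^ 34 := by ring
    have := hmono 6 34 (by norm_num)
    have : u ^ 6 ≤ u ^ 5 / 10 ^ 6 := hstep 5
    linarith [hp 5]
  · have : u ^ 4 * (k * Q ^ 2) ≤ u ^ 4 * u ^ 60 := mul_le_mul_of_nonneg_left hkQ (hp 4).le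
    have e : u ^ 4 * u ^ 60 = u ^ 64 := by ring
    have e2 : u ^ 5 * (u / 200) / 4 = u ^ 6 / 800 := by ring
    rw [e2]
    have := hmono 7 64 (by norm_num)
    have : u ^ 7 ≤ u ^ 6 / 10 ^ 6 := hstep 6
    linarith [hp 6]
  · apply exp_tail_le (by positivity)
    have h1 : Real.sqrt (2 * Q) ≤ u ^ 14 := by
      apply sqrt_le_u hup
      have : u ^ 30 ≤ u ^ 29 / 10 ^ 6 := hstep 29
      have : u ^ 29 ≤ u ^ 28 / 10 ^ 6 := hstep 28
      linarith [hp 29, hp 28]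
    have h2 : (8 + 20 * L) * Real.sqrt (2 * Q) ≤ (8 + 20 * L) * u ^ 14 :=
      mul_le_mul_of_nonneg_left h1 (by positivity)
    have : L * u ^ 14 = u ^ 13 := hLu 13
    have := hmono 6 13 (by norm_num)
    have := hmono 6 14 (by norm_num)
    have : u ^ 6 ≤ u ^ 5 / 10 ^ 6 := hstep 5
    linarith [hp 5]
  · apply exp_tail_le (by positivity)
    have h1 : Real.sqrt (12 * Q * (M0 + 1)) ≤ u ^ 14 := sqrt_le_u hup (hb1.trans h29)
    have h2 : (40 * M0 + 20 * L) * Real.sqrt (12 * Q * (M0 + 1)) ≤ (60 * L) * u ^ 14 :=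
      mul_le_mul (by linarith) h1 (Real.sqrt_nonneg _) (by positivity)
    have : L * u ^ 14 = u ^ 13 := hLu 13
    have := hmono 7 13 (by norm_num)
    have : u ^ 7 ≤ u ^ 6 / 10 ^ 6 := hstep 6
    have e : u ^ 5 * (u / 200) / 8 = u ^ 6 / 1600 := by ring
    rw [e]
    linarith [hp 6]
  · have := exp_tail_le (w := 0) (X := 20 * L) (B := 8 * (u ^ 4) ^ 2 * (u / 200) ^ 2) (s := Q) hQ0 (by
      have h1 : (0 + 20 * L) * Q ≤ 20 * L * u ^ 30 := by
        rw [zero_add]; exact mul_le_mul_of_nonneg_left hQ (by positivity)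
      have e : 8 * (u ^ 4) ^ 2 * (u / 200) ^ 2 = u ^ 10 / 5000 := by ring
      rw [e]
      have : L * u ^ 30 = u ^ 29 := hLu 29
      have := hmono 11 29 (by norm_num)
      have : u ^ 11 ≤ u ^ 10 / 10 ^ 6 := hstep 10
      linarith [hp 10])
    rwa [add_zero] at this
  · rw [hd7]
    have : Real.exp (-(20 * L)) * Real.exp (7 * L) = Real.exp (-(13 * L)) := by
      rw [← Real.exp_add]; ring_nf
    linarith
  · have h1 : 100 * L * Q ≤ 100 * L * u ^ 30 := mul_le_mul_of_nonneg_left hQ (by positivity)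
    have : L * u ^ 30 = u ^ 29 := hLu 29
    have := hmono 1 29 (by norm_num)
    linarith
  · nlinarith
  · rw [hd7]
    have e : Real.exp (-(100 * L / 4)) * Real.exp (7 * L) = Real.exp (-(18 * L)) := by
      rw [← Real.exp_add]; ring_nf
    have : Real.exp (-(18 * L)) ≤ Real.exp (-(13 * L)) := Real.exp_le_exp.2 (by linarith)
    nlinarith [Real.exp_pos (-(13 * L))]

theorem params_exist {β c : ℝ} (hβ : 0 < β) (hc : 0 < c) : ∃ L0 : ℝ, ∀ L : ℝ, L0 ≤ L →
    10 ^ 6 ≤ L ∧ L * Real.exp (-(β * L)) ≤ (1 / L) ^ 30 ∧ 1 ≤ c * L ∧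
    (1 / L) ^ 4 ≤ c ∧
    ∃ T : ℕ, (1 - (1 / L) ^ 4 / 2) ^ T * L ≤ 1 / L / 200 ∧ T * (1 / L) ^ 5 ≤ c := by
  have h1 : ∀ᶠ L : ℝ in Filter.atTop, L ^ 31 ≤ Real.exp (β * L) := by
    have := (isLittleO_pow_exp_pos_mul_atTop (k := 31) hβ).bound (c := 1) one_pos
    filter_upwards [this, Filter.eventually_ge_atTop 0] with L hL h0
    rw [Real.norm_of_nonneg (by positivity), Real.norm_of_nonneg (Real.exp_pos _).le, one_mul] at hL
    exact hL
  have h2 : ∀ᶠ X : ℝ in Filter.atTop, 200 * X ^ 4 ≤ Real.exp (1 / 2 * X) := by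
    have := (isLittleO_pow_exp_pos_mul_atTop (k := 4) (b := 1 / 2) (by norm_num)).bound
      (c := 1 / 200) (by norm_num)
    filter_upwards [this, Filter.eventually_ge_atTop 0] with L hL h0
    rw [Real.norm_of_nonneg (by positivity), Real.norm_of_nonneg (Real.exp_pos _).le] at hL
    linarith
  have h3 := Real.tendsto_sqrt_atTop.eventually h2
  have h4 := Real.tendsto_sqrt_atTop.eventually (Filter.eventually_ge_atTop (2 / c))
  obtain ⟨L0, hL0⟩ := Filter.eventually_atTop.1 (h1.and (h3.and (h4.and
    ((Filter.eventually_ge_atTop (10 ^ 6 : ℝ)).and (Filter.eventually_ge_atTop (1 / c))))))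
  refine ⟨L0, fun L hL => ?_⟩
  obtain ⟨g1, g2, g3, g4, g5⟩ := hL0 L hL
  have hLp : 0 < L := by linarith
  have hX2 : Real.sqrt L ^ 2 = L := Real.sq_sqrt hLp.le
  have hX1 : 1 ≤ Real.sqrt L := by rw [Real.one_le_sqrt]; linarith
  set X := Real.sqrt L with hX
  have hXp : 0 < X := by linarith
  have hcL : 1 ≤ c * L := by rw [div_le_iff₀ hc] at g5; linarith
  have hcX : 2 ≤ c * X := by rw [div_le_iff₀ hc] at g3; linarith
  have hu1 : 1 / L ≤ 1 := by rw [div_le_one hLp]; linarith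
  have hu0 : 0 < 1 / L := by positivity
  refine ⟨g4, ?_, hcL, ?_, ⌈X ^ 9⌉₊, ?_, ?_⟩
  · rw [Real.exp_neg, one_div, inv_pow, ← div_eq_mul_inv, div_le_iff₀ (Real.exp_pos _),
      ← div_eq_inv_mul, le_div_iff₀ (by positivity)]
    calc L * L ^ 30 = L ^ 31 := by ring
      _ ≤ _ := g1
  · refine (pow_le_of_le_one hu0.le hu1 (by norm_num)).trans ?_
    rw [div_le_iff₀ hLp]; exact hcL
  · have hη : 0 ≤ 1 - (1 / L) ^ 4 / 2 := by
      have := pow_le_one₀ hu0.le hu1 (n := 4)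
      linarith
    have k1 : 1 - (1 / L) ^ 4 / 2 ≤ Real.exp (-((1 / L) ^ 4 / 2)) := by
      linarith [Real.add_one_le_exp (-((1 / L) ^ 4 / 2))]
    have k2 := pow_le_pow_left₀ hη k1 ⌈X ^ 9⌉₊
    rw [← Real.exp_nat_mul] at k2
    have k3 : Real.exp ((⌈X ^ 9⌉₊ : ℝ) * (-((1 / L) ^ 4 / 2))) ≤ Real.exp (-(1 / 2 * X)) := by
      apply Real.exp_le_exp.2
      have k4 : X ^ 9 ≤ ⌈X ^ 9⌉₊ := Nat.le_ceil _
      have k5 := mul_le_mul_of_nonneg_right k4 (by positivity : 0 ≤ (1 / L) ^ 4 / 2)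
      have k6 : X ^ 9 * ((1 / L) ^ 4 / 2) = 1 / 2 * X := by
        rw [← hX2]; field_simp
      linarith
    have k7 := mul_le_mul_of_nonneg_right (k2.trans k3) hLp.le
    refine k7.trans ?_
    rw [Real.exp_neg, ← div_eq_inv_mul, div_le_iff₀ (Real.exp_pos _), div_div, one_div,
      ← div_eq_inv_mul, le_div_iff₀ (by positivity)]
    calc L * (L * 200) = 200 * (X ^ 2) ^ 2 := by rw [hX2]; ring
      _ = 200 * X ^ 4 := by ring
      _ ≤ _ := g2
  · have k4 : (⌈X ^ 9⌉₊ : ℝ) ≤ 2 * X ^ 9 := by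
      have := (Nat.ceil_lt_add_one (by positivity : 0 ≤ X ^ 9)).le
      have : 1 ≤ X ^ 9 := one_le_pow₀ hX1
      linarith
    refine (mul_le_mul_of_nonneg_right k4 (by positivity)).trans ?_
    have : 2 * X ^ 9 * (1 / L) ^ 5 = 2 / X := by
      rw [← hX2]; field_simp
    rw [this, div_le_iff₀ hXp]
    exact hcX


set_option linter.unusedSectionVars false
set_option linter.unusedVariables false

theorem anal {γ d k L η : ℝ} (hγ0 : 0 < γ) (hγ1 : γ < 1) (hd : d = Real.exp L) (hL : 0 < L)
    (hk1 : 1 ≤ k) (hk2 : k ≤ d ^ (2 * γ)) (hη0 : 0 < η) (hη : η ≤ γ / 8)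
    (hcL : 16 ≤ (1 - γ) * L) :
    ∃ (l : ℕ) (r : ℝ), 0 < l ∧
      (∀ n : ℕ, 4 * (1 + γ) * d / Real.log (d / Real.sqrt k) ≤ n → l ≤ n) ∧
      (l : ℝ) ≤ d ∧ 1 / l * d ≤ r ∧ 0 < r ∧ 2 * (1 + γ / 4) * r ≤ L ∧
      1 / l * Real.exp (2 * (1 + η) * (2 * (1 + γ / 4) * r)) * Real.sqrt k ≤
        L * Real.exp (-(γ * (1 - γ) / 4 * L)) := by
  have hdp : 0 < d := by rw [hd]; exact Real.exp_pos _
  have hkp : 0 < k := by linarith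
  have hsk : 0 < Real.sqrt k := Real.sqrt_pos.2 hkp
  set s := Real.log (Real.sqrt k) with hs
  have hes : Real.sqrt k = Real.exp s := (Real.exp_log hsk).symm
  have hs0 : 0 ≤ s := Real.log_nonneg (by rw [Real.one_le_sqrt]; exact hk1)
  have hs1 : s ≤ γ * L := by
    rw [hs, Real.log_sqrt hkp.le]
    have h1 := Real.log_le_log hkp hk2
    rw [Real.log_rpow hdp, hd, Real.log_exp] at h1
    linarith
  have hLg : Real.log (d / Real.sqrt k) = L - s := by
    rw [Real.log_div hdp.ne' hsk.ne', hd, Real.log_exp]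
  rw [hLg]
  set g := L - s with hg
  have hg1 : (1 - γ) * L ≤ g := by rw [hg]; linarith
  have hgL : g ≤ L := by rw [hg]; linarith
  have hgp : 0 < g := by linarith
  have hx : 0 < 4 * (1 + γ) * d / g := by positivity
  have hceil := Nat.le_ceil (4 * (1 + γ) * d / g)
  set l := ⌈4 * (1 + γ) * d / g⌉₊ with hl
  have hlp : 0 < l := Nat.ceil_pos.2 hx
  have hlp' : (0:ℝ) < l := by exact_mod_cast hlp
  have hlr : 1 / (l : ℝ) * d ≤ g / (4 * (1 + γ)) := by
    rw [one_div_mul_eq_div, div_le_div_iff₀ hlp' (by positivity)]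
    rw [div_le_iff₀ hgp] at hceil
    linarith
  have hrL : g / (4 * (1 + γ)) ≤ L / 4 := by
    rw [div_le_div_iff₀ (by positivity) (by norm_num)]
    nlinarith
  have hr0 : 0 < g / (4 * (1 + γ)) := by positivity
  refine ⟨l, g / (4 * (1 + γ)), hlp, ?_, ?_, hlr, hr0, ?_, ?_⟩
  · intro n hn; exact Nat.ceil_le.2 hn
  · have h1 := (Nat.ceil_lt_add_one hx.le).le
    have h2 : 4 * (1 + γ) * d / g ≤ d / 2 := by
      rw [div_le_div_iff₀ hgp (by norm_num)]
      nlinarith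
    have h3 : 2 ≤ d := by
      rw [hd]
      have := Real.add_one_le_exp L
      nlinarith
    linarith
  · nlinarith
  · set r := g / (4 * (1 + γ)) with hr
    have hrg : r * (4 * (1 + γ)) = g := by rw [hr]; field_simp
    have h1 : 1 / (l : ℝ) ≤ r * Real.exp (-L) := by
      rw [Real.exp_neg, ← hd, ← div_eq_mul_inv, le_div_iff₀ hdp]; exact hlr
    have hE : 2 * (1 + η) * (2 * (1 + γ / 4) * r) ≤ (1 - γ / 4) * g := by
      rw [← hrg]
      have : (1 + η) * (1 + γ / 4) ≤ (1 - γ / 4) * (1 + γ) := by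
        have : (1 + η) * (1 + γ / 4) ≤ (1 + γ / 8) * (1 + γ / 4) :=
          mul_le_mul_of_nonneg_right (by linarith) (by linarith)
        nlinarith
      have := mul_le_mul_of_nonneg_right this hr0.le
      linarith
    rw [hes]
    calc 1 / (l : ℝ) * Real.exp (2 * (1 + η) * (2 * (1 + γ / 4) * r)) * Real.exp s
        ≤ L * Real.exp (-L) * Real.exp ((1 - γ / 4) * g) * Real.exp s := by
          apply mul_le_mul_of_nonneg_right _ (Real.exp_pos _).le
          apply mul_le_mul _ (Real.exp_le_exp.2 hE) (Real.exp_pos _).le (by positivity)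
          refine h1.trans (mul_le_mul_of_nonneg_right (by linarith) (Real.exp_pos _).le)
      _ = L * Real.exp (-L + (1 - γ / 4) * g + s) := by rw [Real.exp_add, Real.exp_add]; ring
      _ ≤ _ := by
          apply mul_le_mul_of_nonneg_left _ hL.le
          apply Real.exp_le_exp.2
          have := mul_le_mul_of_nonneg_left hg1 hγ0.le
          have : -L + s = -g := by rw [hg]; ring
          nlinarith

section main
variable {V C : Type} [Fintype C] {H : SimpleGraph C} {part : C → V}

theorem init_state {A : Finset C} {W : Finset V} {l : ℕ} {d r M : ℝ} (hl : 0 < l)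
    (hAW : ∀ c ∈ A, part c ∈ W)
    (hcard : ∀ v ∈ W, (Ls part A v).card = l) (hdeg : ∀ c, ((Nb H A c).card : ℝ) ≤ d)
    (hr : 1 / l * d ≤ r) (hM : 0 < M) (hrM : r ≤ M) :
    State H part W A (1 / l) M (1 - r / M) 1 := by
  have hlp' : (0:ℝ) < l := by exact_mod_cast hl
  have hpl : 1 / (l : ℝ) * l = 1 := by field_simp
  have hb : ∀ c, 1 / (l : ℝ) * (Nb H A c).card ≤ r := fun c =>
    (mul_le_mul_of_nonneg_left (hdeg c) (by positivity)).trans hr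
  refine ⟨hAW, ?_, ?_, ?_⟩
  · intro v hv
    rw [hcard v hv, hpl]
  · intro c _
    exact (hb c).trans hrM
  · intro v hv
    have h1 : ∑ c ∈ Ls part A v, (M - r) ≤ ∑ c ∈ Ls part A v, (M - 1 / (l:ℝ) * (Nb H A c).card) :=
      Finset.sum_le_sum fun c _ => by linarith [hb c]
    rw [Finset.sum_const, hcard v hv, nsmul_eq_mul] at h1
    have h2 := mul_le_mul_of_nonneg_left h1 (by positivity : 0 ≤ 1 / (l : ℝ))
    rw [← mul_assoc, hpl, one_mul] at h2
    refine le_trans (le_of_eq ?_) h2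
    field_simp

theorem sparse_sum {k : ℝ} (h : LocallySparse H k) (A : Finset C) (c : C) :
    ∑ c' ∈ Nb H A c, ((Nb H A c ∩ Nb H A c').card : ℝ) ≤ 2 * k := by
  refine le_trans ?_ (h c)
  unfold pairsWithin
  have e : ∑ c' ∈ Nb H A c, (Nb H A c ∩ Nb H A c').card =
      ((Nb H A c).sigma fun c' => Nb H A c ∩ Nb H A c').card := by
    rw [Finset.card_sigma]
  rw [← Nat.cast_sum, e, Nat.cast_le]
  apply Finset.card_le_card_of_injOn (fun j => (j.1, j.2))
  · rintro ⟨x, y⟩ hj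
    rw [Finset.mem_coe, Finset.mem_sigma, Finset.mem_inter, mem_Nb, mem_Nb, mem_Nb] at hj
    simp only [Finset.coe_filter, Set.mem_setOf_eq, Finset.mem_product,
      SimpleGraph.mem_neighborFinset]
    exact ⟨⟨hj.1.2, hj.2.1.2⟩, hj.2.2.2⟩
  · rintro ⟨x, y⟩ _ ⟨x', y'⟩ _ hh
    simp only [Prod.mk.injEq] at hh
    obtain ⟨rfl, rfl⟩ := hh
    rfl

end main

theorem theta_arith {γ r η c n : ℝ} (hγ0 : 0 < γ) (hγ1 : γ < 1) (hr : 0 < r)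
    (hc : c ≤ γ / 20) (h1 : η ≤ c) (h2 : n ≤ c) :
    1 / 2 + η + n ≤ 1 - r / (2 * (1 + γ / 4) * r) := by
  have e : r / (2 * (1 + γ / 4) * r) = 1 / (2 * (1 + γ / 4)) := by field_simp
  rw [e]
  have : 1 / (2 * (1 + γ / 4)) ≤ 1 / 2 - γ / 10 := by
    rw [div_le_iff₀ (by positivity)]
    nlinarith
  linarith

theorem stmt1 (γ : ℝ) (hγ : γ ∈ Set.Ioo (0 : ℝ) 1) :
    ∃ d₀ : ℝ, ∀ d : ℝ, d₀ ≤ d → ∀ k : ℝ, 1 ≤ k → k ≤ d ^ (2 * γ) →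
      ∀ (V C : Type) [Fintype V] [Fintype C] (G : SimpleGraph V) (H : SimpleGraph C)
        (L : V → Finset C),
        IsCorrespondenceCover G H L →
        (∀ c : C, (H.degree c : ℝ) ≤ d) →
        LocallySparse H k →
        (∀ v : V, 4 * (1 + γ) * d / Real.log (d / Real.sqrt k) ≤ ((L v).card : ℝ)) →
        ∃ φ : V → C, (∀ v : V, φ v ∈ L v) ∧ ∀ u v : V, ¬H.Adj (φ u) (φ v) := by
  obtain ⟨hγ0, hγ1⟩ := hγ
  have hγ1' : 0 < 1 - γ := by linarith
  obtain ⟨L0, hL0⟩ := params_exist (β := γ * (1 - γ) / 4) (c := γ * (1 - γ) / 20)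
    (by positivity) (by positivity)
  refine ⟨Real.exp L0, ?_⟩
  intro d hd k hk1 hk2 V C _ _ G H L hcov hdeg hsp hsz
  have hdp : 0 < d := (Real.exp_pos _).trans_le hd
  have hdl : d = Real.exp (Real.log d) := (Real.exp_log hdp).symm
  have hLL : L0 ≤ Real.log d := (Real.le_log_iff_exp_le hdp).2 hd
  obtain ⟨b1, b2, b3, b4, T, b5, b6⟩ := hL0 _ hLL
  clear hL0 hLL hd
  set Λ := Real.log d with hΛ
  have hΛp : 0 < Λ := by linarith
  set u := 1 / Λ with hu
  have hup : 0 < u := by positivity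
  have hc20 : γ * (1 - γ) / 20 ≤ γ / 20 := by nlinarith
  have hc16 : γ * (1 - γ) / 20 ≤ (1 - γ) / 16 := by nlinarith
  have h16 : 16 ≤ (1 - γ) * Λ := by
    have := mul_le_mul_of_nonneg_right hc16 hΛp.le
    linarith
  obtain ⟨l, r, hl, hln, hld, hlr, hr0, hrL, hQk⟩ := anal (η := u ^ 4) hγ0 hγ1 hdl hΛp hk1 hk2
    (by positivity) (by linarith) h16
  have hlp : (0:ℝ) < l := by exact_mod_cast hl
  set M0 := 2 * (1 + γ / 4) * r with hM0
  have hM0p : 0 < M0 := by positivity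
  set Q := 1 / (l : ℝ) * Real.exp (2 * (1 + u ^ 4) * M0) with hQ
  have hQ0 : 0 < Q := by positivity
  have hQs : Q * Real.sqrt k ≤ u ^ 30 := hQk.trans b2
  have hs1 : 1 ≤ Real.sqrt k := by rw [Real.one_le_sqrt]; exact hk1
  have hQ1 : Q ≤ u ^ 30 := le_trans (by nlinarith) hQs
  have hQ2 : k * Q ^ 2 ≤ u ^ 60 := by
    have := pow_le_pow_left₀ (by positivity) hQs 2
    rw [mul_pow, Real.sq_sqrt (by linarith), ← pow_mul] at this
    calc k * Q ^ 2 = Q ^ 2 * k := by ring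
      _ ≤ u ^ (30 * 2) := this
      _ = u ^ 60 := by norm_num
  have hN := num_aux b1 (by rw [hu]; field_simp) hdl hQ0 hQ1 hQ2 hM0p.le hrL (by linarith : 0 ≤ k)
  choose part hpart hpart' using hcov.partition
  have hpu : ∀ c v, c ∈ L v → part c = v := fun c v h => (hpart' c v h).symm
  have htrim : ∀ v, ∃ B ⊆ L v, B.card = l := fun v =>
    Finset.exists_subset_card_eq (hln _ (hsz v))
  choose B hB hBc using htrim
  set A : Finset C := univ.filter fun c => c ∈ B (part c) with hA
  have hLs : ∀ v, Ls part A v = B v := by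
    intro v
    ext c
    rw [mem_Ls, hA, Finset.mem_filter]
    constructor
    · rintro ⟨⟨_, h⟩, rfl⟩; exact h
    · intro h
      have := hpu c v (hB v h)
      exact ⟨⟨Finset.mem_univ _, by rw [this]; exact h⟩, this⟩
  have hdegA : ∀ c, ((Nb H A c).card : ℝ) ≤ d := by
    intro c
    refine le_trans ?_ (hdeg c)
    rw [← SimpleGraph.card_neighborFinset_eq_degree]
    apply Nat.cast_le.2
    apply Finset.card_le_card
    intro x hx
    rw [SimpleGraph.mem_neighborFinset]
    exact (mem_Nb.1 hx).2
  have hnice : Nice H part d A := by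
    refine ⟨?_, ?_, hdegA, ?_⟩
    · intro c c' hadj he
      exact hcov.indep (part c) c (hpart c) c' (he ▸ hpart c') hadj
    · intro c c1 c2 h1 h2 he
      exact hcov.matching (part c) (part c1) c (hpart c) c1 (hpart c1) c2 (he ▸ hpart c2) h1 h2
    · intro v
      rw [hLs, hBc]; exact hld
  have hst : State H part univ A (1 / l) M0 (1 - r / M0) 1 :=
    init_state hl (fun c _ => Finset.mem_univ _) (fun v _ => by rw [hLs, hBc]) hdegA hlr hM0p
      (by rw [hM0]; nlinarith)
  have hpe : 1 / (l : ℝ) = Q * Real.exp (-(2 * (1 + u ^ 4) * M0)) := by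
    rw [hQ, mul_assoc, ← Real.exp_add, add_neg_cancel, Real.exp_zero, mul_one]
  rw [hpe] at hst
  have hη1 : u ^ 4 ≤ 1 / 3 := hN.hη1
  have hpow : (1 - u ^ 4 / 2) ^ T * M0 ≤ u / 200 :=
    (mul_le_mul_of_nonneg_left hrL (pow_nonneg (by linarith) _)).trans b5
  have hcol := iter hN (fun A c _ => sparse_sum hsp A c) T univ A M0 (1 - r / M0) 1 hnice hM0p le_rfl
    hpow (by have : 0 ≤ r / M0 := by positivity
             linarith)
    (theta_arith hγ0 hγ1 hr0 hc20 b4 b6) (by linarith) hst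
  obtain ⟨X, hXA, hX1, hX2⟩ := hcol
  choose φ hφ1 hφ2 using fun v => hX1 v (Finset.mem_univ v)
  refine ⟨φ, fun v => ?_, fun u v => hX2 _ (hφ1 u) _ (hφ1 v)⟩
  have := hpart (φ v)
  rwa [hφ2] at this
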